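/- arXiv:2011.11056 — 2 statements merged into one kernel-verified Lean document; each statement's English description precedes it below -/
import Mathlib

section
/- Let b ∈ {1,2,3}, and set x₀ := 1 if b is odd and x₀ := 2 if b is even. Then for every integer a ≥ b+2 and every real number x > x₀ one has Δ_{a,b}(x) = P_{a−1}(x)·P_{b+1}(x) − P_a(x)·P_b(x) > 0. -/
open Polynomial Finset

/-- The polynomials `P n` defined by `P 0 = 1` and
`n * P n = X * ∑_{k=1}^n σ(k) * P (n-k)`, i.e. the coefficients of
`∏ (1 - q^j)^{-x} = ∑ P_n(x) q^n`. -/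
noncomputable def P : ℕ → Polynomial ℝ
  | 0 => 1
  | n + 1 => ((n + 1 : ℝ)⁻¹) • (X * ∑ k ∈ Finset.range (n + 1),
      ((∑ d ∈ (k + 1).divisors, d : ℕ) : ℝ) • P (n - k))

/-- `Δ a b = P (a-1) * P (b+1) - P a * P b`. -/
noncomputable def Δ (a b : ℕ) : Polynomial ℝ :=
  P (a - 1) * P (b + 1) - P a * P b


set_option linter.unusedSimpArgs false


/-- sum of divisors -/
def sg (n : ℕ) : ℕ := ∑ d ∈ n.divisors, d

lemma sg_lower (n : ℕ) : n ≤ sg n := by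
  rcases Nat.eq_zero_or_pos n with h | h
  · simp [h]
  · exact Finset.single_le_sum (f := fun d => d) (fun _ _ => Nat.zero_le _)
      (Nat.mem_divisors_self n h.ne')

lemma sg_upper (n : ℕ) : 2 * sg n ≤ n * (n + 1) := by
  have h : sg n ≤ ∑ d ∈ Finset.range (n + 1), d := by
    apply Finset.sum_le_sum_of_subset
    intro d hd
    rw [Finset.mem_range]
    exact Nat.lt_succ_of_le (Nat.divisor_le hd)
  have h2 := Finset.sum_range_id_mul_two (n + 1)
  simp only [Nat.add_sub_cancel] at h2
  nlinarith

/-- evaluation of `P` -/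
noncomputable def pe (x : ℝ) (n : ℕ) : ℝ := (P n).eval x

lemma pe_zero (x : ℝ) : pe x 0 = 1 := by simp [pe, P]

lemma pe_rec (x : ℝ) (n : ℕ) :
    (n : ℝ) * pe x n = x * ∑ j ∈ Finset.range n, (sg (n - j) : ℝ) * pe x j := by
  cases n with
  | zero => simp
  | succ n =>
    have hn : ((n : ℝ) + 1) ≠ 0 := by positivity
    have h1 : pe x (n + 1) = ((n : ℝ) + 1)⁻¹ * (x * ∑ k ∈ Finset.range (n + 1),
        (sg (k + 1) : ℝ) * pe x (n - k)) := by
      unfold pe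
      rw [P]
      simp [Polynomial.eval_finsetSum, sg]
    rw [h1, ← Finset.sum_range_reflect]
    push_cast
    rw [← mul_assoc, mul_inv_cancel₀ hn, one_mul]
    congr 1
    apply Finset.sum_congr rfl
    intro j hj
    rw [Finset.mem_range] at hj
    have e3 : n - j + 1 = n + 1 - j := by omega
    have e4 : n - (n - j) = j := by omega
    simp [e3, e4]

lemma pe_pos (x : ℝ) (hx : 0 < x) (n : ℕ) : 0 < pe x n := by
  induction n using Nat.strong_induction_on with
  | _ n ih =>
    rcases Nat.eq_zero_or_pos n with h | h
    · rw [h, pe_zero]; norm_num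
    · have hr := pe_rec x n
      have hs : 0 < ∑ j ∈ Finset.range n, (sg (n - j) : ℝ) * pe x j := by
        apply Finset.sum_pos
        · intro j hj
          rw [Finset.mem_range] at hj
          have := sg_lower (n - j)
          have h3 : 0 < sg (n - j) := by omega
          have h4 : (0 : ℝ) < sg (n - j) := by exact_mod_cast h3
          exact mul_pos h4 (ih j hj)
        · exact ⟨0, by simpa using h⟩
      have hn : (0 : ℝ) < n := by exact_mod_cast h
      have : 0 < (n : ℝ) * pe x n := by rw [hr]; exact mul_pos hx hs
      exact (mul_pos_iff_of_pos_left hn).1 this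

lemma pe_mono_succ (x : ℝ) (hx : 1 ≤ x) (n : ℕ) : pe x n ≤ pe x (n + 1) := by
  induction n using Nat.strong_induction_on with
  | _ n ih =>
    have h1 := pe_rec x n
    have h2 := pe_rec x (n + 1)
    rw [Finset.sum_range_succ'] at h2
    have hs : ∑ j ∈ Finset.range n, (pe x (j + 1) - pe x j) ≤
        ∑ j ∈ Finset.range n, (sg (n - j) : ℝ) * (pe x (j + 1) - pe x j) := by
      apply Finset.sum_le_sum
      intro j hj
      rw [Finset.mem_range] at hj
      have h3 : 1 ≤ sg (n - j) := le_trans (by omega) (sg_lower (n - j))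
      have h4 : (1 : ℝ) ≤ sg (n - j) := by exact_mod_cast h3
      have := ih j hj
      nlinarith
    rw [Finset.sum_range_sub] at hs
    simp only [mul_sub, Finset.sum_sub_distrib] at hs
    have e : ∀ j, n + 1 - (j + 1) = n - j := fun j => by omega
    simp only [e, pe_zero, Nat.sub_zero] at h2
    rw [pe_zero] at hs
    have h5 : 1 ≤ sg (n + 1) := le_trans (by omega) (sg_lower (n + 1))
    have h6 : (1 : ℝ) ≤ sg (n + 1) := by exact_mod_cast h5
    have hp := pe_pos x (by linarith) n
    push_cast at h2
    set A := ∑ j ∈ Finset.range n, (sg (n - j) : ℝ) * pe x (j + 1)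
    set B := ∑ j ∈ Finset.range n, (sg (n - j) : ℝ) * pe x j
    have h7 : pe x n ≤ A - B + sg (n + 1) * 1 := by linarith
    have h8 : x * pe x n ≤ x * (A - B + sg (n + 1) * 1) :=
      mul_le_mul_of_nonneg_left h7 (by linarith)
    have h9 : ((n : ℝ) + 1) * pe x n ≤ ((n : ℝ) + 1) * pe x (n + 1) := by
      have : pe x n ≤ x * pe x n := by nlinarith
      linarith
    exact le_of_mul_le_mul_left h9 (by positivity)

lemma pe_mono (x : ℝ) (hx : 1 ≤ x) : Monotone (pe x) :=
  monotone_nat_of_le_succ (pe_mono_succ x hx)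

lemma choose_sum (m n : ℕ) :
    ∑ i ∈ Finset.range n, (n - i) * i.choose m = (n + 1).choose (m + 2) := by
  induction n with
  | zero => rw [Nat.choose_eq_zero_of_lt (by omega)]; simp
  | succ n ih =>
    have h0 : ∑ i ∈ Finset.range (n + 1), i.choose m = (n + 1).choose (m + 1) := by
      clear ih
      induction n with
      | zero => cases m <;> simp [Nat.choose_succ_succ]
      | succ k ik => rw [Finset.sum_range_succ, ik, Nat.choose_succ_succ (k + 1) m]; ring
    have h1 : ∑ i ∈ Finset.range (n + 1), (n + 1 - i) * i.choose m =
        ∑ i ∈ Finset.range (n + 1), ((n - i) * i.choose m + i.choose m) := by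
      apply Finset.sum_congr rfl
      intro i hi
      rw [Finset.mem_range] at hi
      have : n + 1 - i = (n - i) + 1 := by omega
      rw [this]; ring
    rw [h1, Finset.sum_add_distrib, h0, Finset.sum_range_succ, ih,
      Nat.choose_succ_succ (n + 1) (m + 1)]
    simp
    ring

lemma choose_sum_real (m n : ℕ) :
    ∑ i ∈ Finset.range n, ((n - i : ℕ) : ℝ) * (i.choose m : ℝ) =
      ((n : ℝ) + 1) * (n.choose (m + 1) : ℝ) / (m + 2) := by
  have h := choose_sum m n
  have h2 := Nat.add_one_mul_choose_eq n (m + 1)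
  have h3 : ((n : ℝ) + 1) * (n.choose (m + 1) : ℝ) = ((n + 1).choose (m + 2) : ℝ) * (m + 2) := by
    have := congrArg (Nat.cast (R := ℝ)) h2
    push_cast at this
    rw [this]; ring
  rw [h3, mul_div_assoc, div_self (by positivity), mul_one, ← h]
  push_cast
  rfl

lemma pe_lower (x : ℝ) (hx : 0 < x) (M n : ℕ) :
    ∑ m ∈ Finset.range M, (n.choose m : ℝ) * x ^ (m + 1) / ((m + 1).factorial : ℝ)
      ≤ pe x (n + 1) := by
  induction M generalizing n with
  | zero => simpa using (pe_pos x hx (n + 1)).le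
  | succ M ih =>
    have h2 := pe_rec x (n + 1)
    rw [Finset.sum_range_succ'] at h2
    have e : ∀ j, n + 1 - (j + 1) = n - j := fun j => by omega
    simp only [e, pe_zero, Nat.sub_zero] at h2
    have h5 : ((n + 1 : ℕ) : ℝ) ≤ sg (n + 1) := by exact_mod_cast sg_lower (n + 1)
    have hs : ∑ i ∈ Finset.range n, ((n - i : ℕ) : ℝ) *
        (∑ m ∈ Finset.range M, (i.choose m : ℝ) * x ^ (m + 1) / ((m + 1).factorial : ℝ)) ≤
        ∑ i ∈ Finset.range n, (sg (n - i) : ℝ) * pe x (i + 1) := by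
      apply Finset.sum_le_sum
      intro i _
      have h6 : ((n - i : ℕ) : ℝ) ≤ sg (n - i) := by exact_mod_cast sg_lower (n - i)
      have h7 := ih i
      have h8 := pe_pos x hx (i + 1)
      exact mul_le_mul h6 h7 (Finset.sum_nonneg fun m _ => by positivity) (by positivity)
    have hsum : ∑ i ∈ Finset.range n, ((n - i : ℕ) : ℝ) *
        (∑ m ∈ Finset.range M, (i.choose m : ℝ) * x ^ (m + 1) / ((m + 1).factorial : ℝ)) =
        ((n : ℝ) + 1) * ∑ m ∈ Finset.range M,
          (n.choose (m + 1) : ℝ) * x ^ (m + 1) / ((m + 2).factorial : ℝ) := by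
      simp only [Finset.mul_sum]
      rw [Finset.sum_comm]
      apply Finset.sum_congr rfl
      intro m _
      have := choose_sum_real m n
      have h9 : ∑ i ∈ Finset.range n, ((n - i : ℕ) : ℝ) *
          ((i.choose m : ℝ) * x ^ (m + 1) / ((m + 1).factorial : ℝ)) =
          (∑ i ∈ Finset.range n, ((n - i : ℕ) : ℝ) * (i.choose m : ℝ)) *
            (x ^ (m + 1) / ((m + 1).factorial : ℝ)) := by
        rw [Finset.sum_mul]
        apply Finset.sum_congr rfl
        intro i _
        ring
      rw [h9, this, Nat.factorial_succ (m + 1)]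
      have hf : ((m + 1).factorial : ℝ) ≠ 0 := by positivity
      have hm : (m : ℝ) + 2 ≠ 0 := by positivity
      push_cast
      have hm' : (m : ℝ) + 1 + 1 ≠ 0 := by positivity
      field_simp
      ring
    rw [hsum] at hs
    rw [Finset.sum_range_succ']
    have h10 : ∑ m ∈ Finset.range M, (n.choose (m + 1) : ℝ) * x ^ (m + 1 + 1) /
        ((m + 1 + 1).factorial : ℝ) = x * ∑ m ∈ Finset.range M,
          (n.choose (m + 1) : ℝ) * x ^ (m + 1) / ((m + 2).factorial : ℝ) := by
      rw [Finset.mul_sum]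
      apply Finset.sum_congr rfl
      intro m _
      ring
    rw [h10]
    simp only [Nat.choose_zero_right, zero_add, pow_one, Nat.factorial_one, Nat.cast_one,
      one_mul, div_one]
    push_cast at h2 h5
    set Q := ∑ m ∈ Finset.range M,
          (n.choose (m + 1) : ℝ) * x ^ (m + 1) / ((m + 2).factorial : ℝ)
    have hn : (0 : ℝ) < (n : ℝ) + 1 := by positivity
    have h11 : ((n : ℝ) + 1) * (x * Q + x) ≤ ((n : ℝ) + 1) * pe x (n + 1) := by
      rw [h2]
      have : x * (((n : ℝ) + 1) * Q + ((n : ℝ) + 1)) ≤ x * (∑ i ∈ Finset.range n,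
          (sg (n - i) : ℝ) * pe x (i + 1) + (sg (n + 1) : ℝ) * 1) :=
        mul_le_mul_of_nonneg_left (by linarith) hx.le
      linarith
    exact le_of_mul_le_mul_left h11 hn

lemma choose_two_real (n : ℕ) : (n.choose 2 : ℝ) = n * (n - 1) / 2 := Nat.cast_choose_two ℝ n

lemma choose_succ_real (n k : ℕ) :
    (n.choose (k + 1) : ℝ) = n.choose k * ((n : ℝ) - k) / (k + 1) := by
  have h := Nat.choose_succ_right_eq n k
  have hk : (k : ℝ) + 1 ≠ 0 := by positivity
  rw [eq_div_iff hk]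
  by_cases hkn : k ≤ n
  · have := congrArg (Nat.cast (R := ℝ)) h
    push_cast [Nat.cast_sub hkn] at this
    exact this
  · rw [Nat.choose_eq_zero_of_lt (by omega : n < k + 1),
      Nat.choose_eq_zero_of_lt (by omega : n < k)]
    simp

/-- explicit lower bound -/
lemma pe_lower5 (x : ℝ) (hx : 0 < x) (n : ℕ) :
    x + n * x ^ 2 / 2 + n * (n - 1) / 2 * x ^ 3 / 6 + n * (n - 1) * (n - 2) / 6 * x ^ 4 / 24
      + n * (n - 1) * (n - 2) * (n - 3) / 24 * x ^ 5 / 120 ≤ pe x (n + 1) := by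
  have h := pe_lower x hx 5 n
  simp only [Finset.sum_range_succ, Finset.sum_range_zero, choose_succ_real,
    Nat.choose_zero_right, Nat.factorial] at h
  push_cast at h
  refine le_trans (le_of_eq ?_) h
  ring

/-- the differences -/
noncomputable def DD (x : ℝ) (b : ℕ) : ℕ → ℝ
  | 0 => - pe x b
  | j + 1 => pe x (b + 1) * pe x j - pe x (j + 1) * pe x b

lemma DD_rec (x : ℝ) (b n : ℕ) :
    ((n : ℝ) + 1) * DD x b (n + 1) = pe x (b + 1) * pe x n +
      x * ∑ j ∈ Finset.range (n + 1), (sg (n + 1 - j) : ℝ) * DD x b j := by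
  have h1 := pe_rec x n
  have h2 := pe_rec x (n + 1)
  rw [Finset.sum_range_succ'] at h2 ⊢
  have e : ∀ j, n + 1 - (j + 1) = n - j := fun j => by omega
  simp only [e, pe_zero, Nat.sub_zero] at h2 ⊢
  have h3 : ∑ j ∈ Finset.range n, (sg (n - j) : ℝ) * DD x b (j + 1) =
      pe x (b + 1) * (∑ j ∈ Finset.range n, (sg (n - j) : ℝ) * pe x j) -
      pe x b * (∑ j ∈ Finset.range n, (sg (n - j) : ℝ) * pe x (j + 1)) := by
    rw [Finset.mul_sum, Finset.mul_sum, ← Finset.sum_sub_distrib]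
    apply Finset.sum_congr rfl
    intro j _
    simp only [DD]
    ring
  rw [h3]
  simp only [DD]
  push_cast at h2
  linear_combination pe x (b + 1) * h1 - pe x b * h2

lemma DD_step (x : ℝ) (hx : 0 < x) (b n : ℕ) (hn : b + 1 ≤ n) (E : ℕ → ℝ) (S : ℝ)
    (hE0 : ∀ j, j ≤ b → 0 ≤ E j) (hE : ∀ j, j ≤ b → - E j ≤ DD x b j)
    (hS : ∀ k, k ≤ n + 1 → (sg k : ℝ) ≤ S)
    (ih : ∀ j, b + 2 ≤ j → j < n + 1 → 0 < DD x b j)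
    (h : x * (S * ∑ j ∈ Finset.range (b + 1), E j) < pe x (b + 1) * pe x n) :
    0 < DD x b (n + 1) := by
  have hr := DD_rec x b n
  have h0 : DD x b (b + 1) = 0 := by simp only [DD]; ring
  have h1 : ∑ j ∈ Finset.range (b + 1), (sg (n + 1 - j) : ℝ) * DD x b j ≤
      ∑ j ∈ Finset.range (n + 1), (sg (n + 1 - j) : ℝ) * DD x b j := by
    apply Finset.sum_le_sum_of_subset_of_nonneg
    · intro j hj
      rw [Finset.mem_range] at hj ⊢
      omega
    · intro j hj hj'
      rw [Finset.mem_range] at hj hj'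
      have : 0 ≤ DD x b j := by
        rcases Nat.lt_or_ge j (b + 2) with h3 | h3
        · have : j = b + 1 := by omega
          rw [this, h0]
        · exact (ih j h3 hj).le
      positivity
  have h2 : - (S * ∑ j ∈ Finset.range (b + 1), E j) ≤
      ∑ j ∈ Finset.range (b + 1), (sg (n + 1 - j) : ℝ) * DD x b j := by
    rw [Finset.mul_sum, ← Finset.sum_neg_distrib]
    apply Finset.sum_le_sum
    intro j hj
    rw [Finset.mem_range] at hj
    have a1 := hE0 j (by omega)
    have a2 := hE j (by omega)
    have a3 := hS (n + 1 - j) (by omega)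
    have a4 : (0 : ℝ) ≤ sg (n + 1 - j) := by positivity
    nlinarith
  have h3 : 0 < ((n : ℝ) + 1) * DD x b (n + 1) := by
    rw [hr]
    have := mul_le_mul_of_nonneg_left (h2.trans h1) hx.le
    linarith
  exact (mul_pos_iff_of_pos_left (by positivity)).1 h3

lemma sg_1 : sg 1 = 1 := by decide +kernel

lemma sg_2 : sg 2 = 3 := by decide +kernel

lemma sg_3 : sg 3 = 4 := by decide +kernel

lemma sg_4 : sg 4 = 7 := by decide +kernel

lemma sg_5 : sg 5 = 6 := by decide +kernel

lemma sg_6 : sg 6 = 12 := by decide +kernel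

lemma sg_7 : sg 7 = 8 := by decide +kernel

lemma sg_8 : sg 8 = 15 := by decide +kernel

lemma sg_9 : sg 9 = 13 := by decide +kernel

lemma sg_10 : sg 10 = 18 := by decide +kernel

lemma sg_11 : sg 11 = 12 := by decide +kernel

lemma pe_1 (x : ℝ) : pe x 1 =
    1 / 1 * x ^ 1 := by
  have h := pe_rec x 1
  simp only [Finset.sum_range_succ, Finset.sum_range_zero, Nat.reduceSub, sg_1, sg_2, sg_3, sg_4, sg_5, sg_6, sg_7, sg_8, sg_9, sg_10, sg_11, pe_zero] at h
  push_cast at h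
  linear_combination h / 1

lemma pe_2 (x : ℝ) : pe x 2 =
    3 / 2 * x ^ 1 + 1 / 2 * x ^ 2 := by
  have h := pe_rec x 2
  simp only [Finset.sum_range_succ, Finset.sum_range_zero, Nat.reduceSub, sg_1, sg_2, sg_3, sg_4, sg_5, sg_6, sg_7, sg_8, sg_9, sg_10, sg_11, pe_zero, pe_1] at h
  push_cast at h
  linear_combination h / 2

lemma pe_3 (x : ℝ) : pe x 3 =
    4 / 3 * x ^ 1 + 3 / 2 * x ^ 2 + 1 / 6 * x ^ 3 := by
  have h := pe_rec x 3
  simp only [Finset.sum_range_succ, Finset.sum_range_zero, Nat.reduceSub, sg_1, sg_2, sg_3, sg_4, sg_5, sg_6, sg_7, sg_8, sg_9, sg_10, sg_11, pe_zero, pe_1, pe_2] at h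
  push_cast at h
  linear_combination h / 3

lemma pe_4 (x : ℝ) : pe x 4 =
    7 / 4 * x ^ 1 + 59 / 24 * x ^ 2 + 3 / 4 * x ^ 3 + 1 / 24 * x ^ 4 := by
  have h := pe_rec x 4
  simp only [Finset.sum_range_succ, Finset.sum_range_zero, Nat.reduceSub, sg_1, sg_2, sg_3, sg_4, sg_5, sg_6, sg_7, sg_8, sg_9, sg_10, sg_11, pe_zero, pe_1, pe_2, pe_3] at h
  push_cast at h
  linear_combination h / 4

lemma pe_5 (x : ℝ) : pe x 5 =
    6 / 5 * x ^ 1 + 15 / 4 * x ^ 2 + 43 / 24 * x ^ 3 + 1 / 4 * x ^ 4 + 1 / 120 * x ^ 5 := by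
  have h := pe_rec x 5
  simp only [Finset.sum_range_succ, Finset.sum_range_zero, Nat.reduceSub, sg_1, sg_2, sg_3, sg_4, sg_5, sg_6, sg_7, sg_8, sg_9, sg_10, sg_11, pe_zero, pe_1, pe_2, pe_3, pe_4] at h
  push_cast at h
  linear_combination h / 5

lemma pe_6 (x : ℝ) : pe x 6 =
    2 / 1 * x ^ 1 + 1697 / 360 * x ^ 2 + 55 / 16 * x ^ 3 + 113 / 144 * x ^ 4 + 1 / 16 * x ^ 5 + 1 / 720 * x ^ 6 := by
  have h := pe_rec x 6
  simp only [Finset.sum_range_succ, Finset.sum_range_zero, Nat.reduceSub, sg_1, sg_2, sg_3, sg_4, sg_5, sg_6, sg_7, sg_8, sg_9, sg_10, sg_11, pe_zero, pe_1, pe_2, pe_3, pe_4, pe_5] at h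
  push_cast at h
  linear_combination h / 6

lemma pe_7 (x : ℝ) : pe x 7 =
    8 / 7 * x ^ 1 + 92 / 15 * x ^ 2 + 2021 / 360 * x ^ 3 + 89 / 48 * x ^ 4 + 35 / 144 * x ^ 5 + 1 / 80 * x ^ 6 + 1 / 5040 * x ^ 7 := by
  have h := pe_rec x 7
  simp only [Finset.sum_range_succ, Finset.sum_range_zero, Nat.reduceSub, sg_1, sg_2, sg_3, sg_4, sg_5, sg_6, sg_7, sg_8, sg_9, sg_10, sg_11, pe_zero, pe_1, pe_2, pe_3, pe_4, pe_5, pe_6] at h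
  push_cast at h
  linear_combination h / 7

lemma pe_8 (x : ℝ) : pe x 8 =
    15 / 8 * x ^ 1 + 8147 / 1120 * x ^ 2 + 4049 / 480 * x ^ 3 + 21127 / 5760 * x ^ 4 + 11 / 16 * x ^ 5 + 167 / 2880 * x ^ 6 + 1 / 480 * x ^ 7 + 1 / 40320 * x ^ 8 := by
  have h := pe_rec x 8
  simp only [Finset.sum_range_succ, Finset.sum_range_zero, Nat.reduceSub, sg_1, sg_2, sg_3, sg_4, sg_5, sg_6, sg_7, sg_8, sg_9, sg_10, sg_11, pe_zero, pe_1, pe_2, pe_3, pe_4, pe_5, pe_6, pe_7] at h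
  push_cast at h
  linear_combination h / 8

lemma pe_9 (x : ℝ) : pe x 9 =
    13 / 9 * x ^ 1 + 7019 / 840 * x ^ 2 + 1083899 / 90720 * x ^ 3 + 3097 / 480 * x ^ 4 + 27589 / 17280 * x ^ 5 + 23 / 120 * x ^ 6 + 97 / 8640 * x ^ 7 + 1 / 3360 * x ^ 8 + 1 / 362880 * x ^ 9 := by
  have h := pe_rec x 9
  simp only [Finset.sum_range_succ, Finset.sum_range_zero, Nat.reduceSub, sg_1, sg_2, sg_3, sg_4, sg_5, sg_6, sg_7, sg_8, sg_9, sg_10, sg_11, pe_zero, pe_1, pe_2, pe_3, pe_4, pe_5, pe_6, pe_7, pe_8] at h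
  push_cast at h
  linear_combination h / 9

lemma pe_10 (x : ℝ) : pe x 10 =
    9 / 5 * x ^ 1 + 252019 / 25200 * x ^ 2 + 64193 / 4032 * x ^ 3 + 59453 / 5670 * x ^ 4 + 7457 / 2304 * x ^ 5 + 88453 / 172800 * x ^ 6 + 49 / 1152 * x ^ 7 + 221 / 120960 * x ^ 8 + 1 / 26880 * x ^ 9 + 1 / 3628800 * x ^ 10 := by
  have h := pe_rec x 10
  simp only [Finset.sum_range_succ, Finset.sum_range_zero, Nat.reduceSub, sg_1, sg_2, sg_3, sg_4, sg_5, sg_6, sg_7, sg_8, sg_9, sg_10, sg_11, pe_zero, pe_1, pe_2, pe_3, pe_4, pe_5, pe_6, pe_7, pe_8, pe_9] at h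
  push_cast at h
  linear_combination h / 10

lemma pe_11 (x : ℝ) : pe x 11 =
    12 / 11 * x ^ 1 + 163 / 15 * x ^ 2 + 524729 / 25200 * x ^ 3 + 192907 / 12096 * x ^ 4 + 270239 / 45360 * x ^ 5 + 2713 / 2304 * x ^ 6 + 22223 / 172800 * x ^ 7 + 1 / 128 * x ^ 8 + 31 / 120960 * x ^ 9 + 1 / 241920 * x ^ 10 + 1 / 39916800 * x ^ 11 := by
  have h := pe_rec x 11
  simp only [Finset.sum_range_succ, Finset.sum_range_zero, Nat.reduceSub, sg_1, sg_2, sg_3, sg_4, sg_5, sg_6, sg_7, sg_8, sg_9, sg_10, sg_11, pe_zero, pe_1, pe_2, pe_3, pe_4, pe_5, pe_6, pe_7, pe_8, pe_9, pe_10] at h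
  push_cast at h
  linear_combination h / 11

lemma base_1_3 (t : ℝ) (ht : 0 < t) : 0 < DD (1 + t) 1 3 := by
  have h : DD (1 + t) 1 3 = 1 / 1 + 13 / 6 * t ^ 1 + 17 / 12 * t ^ 2 + 1 / 3 * t ^ 3 + 1 / 12 * t ^ 4 := by
    simp only [DD, Nat.reduceAdd, pe_1, pe_2, pe_3, pe_4, pe_5, pe_6, pe_7, pe_8, pe_9, pe_10, pe_11]
    ring
  rw [h]
  positivity

lemma base_1_4 (t : ℝ) (ht : 0 < t) : 0 < DD (1 + t) 1 4 := by
  have h : DD (1 + t) 1 4 = 1 / 1 + 37 / 12 * t ^ 1 + 85 / 24 * t ^ 2 + 15 / 8 * t ^ 3 + 11 / 24 * t ^ 4 + 1 / 24 * t ^ 5 := by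
    simp only [DD, Nat.reduceAdd, pe_1, pe_2, pe_3, pe_4, pe_5, pe_6, pe_7, pe_8, pe_9, pe_10, pe_11]
    ring
  rw [h]
  positivity

lemma base_1_5 (t : ℝ) (ht : 0 < t) : 0 < DD (1 + t) 1 5 := by
  have h : DD (1 + t) 1 5 = 3 / 1 + 171 / 20 * t ^ 1 + 93 / 10 * t ^ 2 + 83 / 16 * t ^ 3 + 27 / 16 * t ^ 4 + 21 / 80 * t ^ 5 + 1 / 80 * t ^ 6 := by
    simp only [DD, Nat.reduceAdd, pe_1, pe_2, pe_3, pe_4, pe_5, pe_6, pe_7, pe_8, pe_9, pe_10, pe_11]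
    ring
  rw [h]
  positivity

lemma base_1_6 (t : ℝ) (ht : 0 < t) : 0 < DD (1 + t) 1 6 := by
  have h : DD (1 + t) 1 6 = 3 / 1 + 173 / 15 * t ^ 1 + 3083 / 180 * t ^ 2 + 4489 / 360 * t ^ 3 + 43 / 9 * t ^ 4 + 179 / 180 * t ^ 5 + 17 / 180 * t ^ 6 + 1 / 360 * t ^ 7 := by
    simp only [DD, Nat.reduceAdd, pe_1, pe_2, pe_3, pe_4, pe_5, pe_6, pe_7, pe_8, pe_9, pe_10, pe_11]
    ring
  rw [h]
  positivity

lemma base_1_7 (t : ℝ) (ht : 0 < t) : 0 < DD (1 + t) 1 7 := by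
  have h : DD (1 + t) 1 7 = 7 / 1 + 2011 / 84 * t ^ 1 + 4231 / 126 * t ^ 2 + 1841 / 72 * t ^ 3 + 3317 / 288 * t ^ 4 + 427 / 144 * t ^ 5 + 29 / 72 * t ^ 6 + 25 / 1008 * t ^ 7 + 1 / 2016 * t ^ 8 := by
    simp only [DD, Nat.reduceAdd, pe_1, pe_2, pe_3, pe_4, pe_5, pe_6, pe_7, pe_8, pe_9, pe_10, pe_11]
    ring
  rw [h]
  positivity

lemma base_1_8 (t : ℝ) (ht : 0 < t) : 0 < DD (1 + t) 1 8 := by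
  have h : DD (1 + t) 1 8 = 8 / 1 + 9301 / 280 * t ^ 1 + 62457 / 1120 * t ^ 2 + 3439 / 70 * t ^ 3 + 47843 / 1920 * t ^ 4 + 4821 / 640 * t ^ 5 + 1259 / 960 * t ^ 6 + 811 / 6720 * t ^ 7 + 23 / 4480 * t ^ 8 + 1 / 13440 * t ^ 9 := by
    simp only [DD, Nat.reduceAdd, pe_1, pe_2, pe_3, pe_4, pe_5, pe_6, pe_7, pe_8, pe_9, pe_10, pe_11]
    ring
  rw [h]
  positivity

/-- bound for the first differences -/
noncomputable def E1 (t : ℝ) : ℕ → ℝ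
  | 0 => 1 / 1 + 1 / 1 * t ^ 1
  | 1 => 1 / 2 * t ^ 2
  | _ => 0

lemma E1_nonneg (t : ℝ) (ht : 0 < t) (j : ℕ) (hj : j ≤ 1) : 0 ≤ E1 t j := by
  interval_cases j <;> simp only [E1] <;> positivity

lemma E1_le (t : ℝ) (ht : 0 < t) (j : ℕ) (hj : j ≤ 1) : - E1 t j ≤ DD (1 + t) 1 j := by
  rw [neg_le_iff_add_nonneg]
  interval_cases j <;> simp only [E1, DD, Nat.reduceAdd, pe_zero, pe_1, pe_2, pe_3, pe_4, pe_5, pe_6, pe_7, pe_8, pe_9, pe_10, pe_11] <;> ring_nf <;> positivity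

lemma main_1 (t : ℝ) (ht : 0 < t) (a : ℕ) (ha : 3 ≤ a) : 0 < DD (1 + t) 1 a := by
  induction a using Nat.strong_induction_on with
  | _ a ih =>
    rcases Nat.lt_or_ge a 9 with h1 | h1
    · interval_cases a
      · exact base_1_3 t ht
      · exact base_1_4 t ht
      · exact base_1_5 t ht
      · exact base_1_6 t ht
      · exact base_1_7 t ht
      · exact base_1_8 t ht
    obtain ⟨n, rfl⟩ : ∃ n, a = n + 1 := ⟨a - 1, by omega⟩
    rcases Nat.lt_or_ge n 21 with h2 | h2
    · apply DD_step (1 + t) (by linarith) 1 n (by omega) (E1 t) 44 (E1_nonneg t ht)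
        (E1_le t ht) _ (fun j hj1 hj2 => ih j hj2 hj1)
      · have h3 : pe (1 + t) 8 ≤ pe (1 + t) n := pe_mono _ (by linarith) (by omega)
        have h4 := mul_le_mul_of_nonneg_left h3 (pe_pos (1 + t) (by linarith) 2).le
        refine lt_of_lt_of_le ?_ h4
        rw [← sub_pos]
        simp only [Finset.sum_range_succ, Finset.sum_range_zero, E1, Nat.reduceAdd, pe_1, pe_2, pe_3, pe_4, pe_5, pe_6, pe_7, pe_8, pe_9, pe_10, pe_11]
        ring_nf
        positivity
      · intro k hk
        have h3 : ∀ k < 22, sg k ≤ 44 := by decide +kernel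
        exact_mod_cast h3 k (by omega)
    · apply DD_step (1 + t) (by linarith) 1 n (by omega) (E1 t)
        (((n : ℝ) + 1) * (n + 2) / 2) (E1_nonneg t ht)
        (E1_le t ht) _ (fun j hj1 hj2 => ih j hj2 hj1)
      · obtain ⟨s, rfl⟩ : ∃ s, n = s + 20 + 1 := ⟨n - 21, by omega⟩
        have h3 := pe_lower5 (1 + t) (by linarith) (s + 20)
        have h4 := mul_le_mul_of_nonneg_left h3 (pe_pos (1 + t) (by linarith) 2).le
        refine lt_of_lt_of_le ?_ h4
        have hs : (0 : ℝ) ≤ s := Nat.cast_nonneg s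
        push_cast
        generalize (s : ℝ) = r at hs
        rw [← sub_pos]
        simp only [Finset.sum_range_succ, Finset.sum_range_zero, E1, Nat.reduceAdd, pe_1, pe_2, pe_3, pe_4, pe_5, pe_6, pe_7, pe_8, pe_9, pe_10, pe_11]
        ring_nf
        positivity
      · intro k hk
        have h3 := sg_upper k
        have h5 : k * (k + 1) ≤ (n + 1) * (n + 2) := Nat.mul_le_mul hk (by omega)
        have h6 : ((2 * sg k : ℕ) : ℝ) ≤ (((n + 1) * (n + 2) : ℕ) : ℝ) := by
          exact_mod_cast h3.trans h5
        push_cast at h6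
        linarith

lemma base_2_4 (t : ℝ) (ht : 0 < t) : 0 < DD (2 + t) 2 4 := by
  have h : DD (2 + t) 2 4 = 85 / 12 * t ^ 1 + 191 / 18 * t ^ 2 + 277 / 48 * t ^ 3 + 199 / 144 * t ^ 4 + 7 / 48 * t ^ 5 + 1 / 144 * t ^ 6 := by
    simp only [DD, Nat.reduceAdd, pe_1, pe_2, pe_3, pe_4, pe_5, pe_6, pe_7, pe_8, pe_9, pe_10, pe_11]
    ring
  rw [h]
  positivity

lemma base_2_5 (t : ℝ) (ht : 0 < t) : 0 < DD (2 + t) 2 5 := by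
  have h : DD (2 + t) 2 5 = 20 / 1 + 48 / 1 * t ^ 1 + 2161 / 45 * t ^ 2 + 2281 / 90 * t ^ 3 + 133 / 18 * t ^ 4 + 83 / 72 * t ^ 5 + 4 / 45 * t ^ 6 + 1 / 360 * t ^ 7 := by
    simp only [DD, Nat.reduceAdd, pe_1, pe_2, pe_3, pe_4, pe_5, pe_6, pe_7, pe_8, pe_9, pe_10, pe_11]
    ring
  rw [h]
  positivity

lemma base_2_6 (t : ℝ) (ht : 0 < t) : 0 < DD (2 + t) 2 6 := by
  have h : DD (2 + t) 2 6 = 35 / 1 + 439 / 4 * t ^ 1 + 47053 / 360 * t ^ 2 + 56897 / 720 * t ^ 3 + 38489 / 1440 * t ^ 4 + 187 / 36 * t ^ 5 + 409 / 720 * t ^ 6 + 23 / 720 * t ^ 7 + 1 / 1440 * t ^ 8 := by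
    simp only [DD, Nat.reduceAdd, pe_1, pe_2, pe_3, pe_4, pe_5, pe_6, pe_7, pe_8, pe_9, pe_10, pe_11]
    ring
  rw [h]
  positivity

lemma base_2_7 (t : ℝ) (ht : 0 < t) : 0 < DD (2 + t) 2 7 := by
  have h : DD (2 + t) 2 7 = 100 / 1 + 5774 / 21 * t ^ 1 + 14453 / 45 * t ^ 2 + 77785 / 378 * t ^ 3 + 3524 / 45 * t ^ 4 + 271 / 15 * t ^ 5 + 901 / 360 * t ^ 6 + 101 / 504 * t ^ 7 + 1 / 120 * t ^ 8 + 1 / 7560 * t ^ 9 := by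
    simp only [DD, Nat.reduceAdd, pe_1, pe_2, pe_3, pe_4, pe_5, pe_6, pe_7, pe_8, pe_9, pe_10, pe_11]
    ring
  rw [h]
  positivity

lemma base_2_8 (t : ℝ) (ht : 0 < t) : 0 < DD (2 + t) 2 8 := by
  have h : DD (2 + t) 2 8 = 175 / 1 + 12935 / 24 * t ^ 1 + 1388291 / 2016 * t ^ 2 + 5811619 / 12096 * t ^ 3 + 4886437 / 24192 * t ^ 4 + 122519 / 2304 * t ^ 5 + 20329 / 2304 * t ^ 6 + 1043 / 1152 * t ^ 7 + 55 / 1008 * t ^ 8 + 83 / 48384 * t ^ 9 + 1 / 48384 * t ^ 10 := by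
    simp only [DD, Nat.reduceAdd, pe_1, pe_2, pe_3, pe_4, pe_5, pe_6, pe_7, pe_8, pe_9, pe_10, pe_11]
    ring
  rw [h]
  positivity

/-- bound for the first differences -/
noncomputable def E2 (t : ℝ) : ℕ → ℝ
  | 0 => 5 / 1 + 7 / 2 * t ^ 1 + 1 / 2 * t ^ 2
  | 1 => 8 / 3 * t ^ 1 + 2 / 1 * t ^ 2 + 1 / 3 * t ^ 3
  | 2 => 5 / 1 + 19 / 3 * t ^ 1 + 35 / 12 * t ^ 2 + 2 / 3 * t ^ 3 + 1 / 12 * t ^ 4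
  | _ => 0

lemma E2_nonneg (t : ℝ) (ht : 0 < t) (j : ℕ) (hj : j ≤ 2) : 0 ≤ E2 t j := by
  interval_cases j <;> simp only [E2] <;> positivity

lemma E2_le (t : ℝ) (ht : 0 < t) (j : ℕ) (hj : j ≤ 2) : - E2 t j ≤ DD (2 + t) 2 j := by
  rw [neg_le_iff_add_nonneg]
  interval_cases j <;> simp only [E2, DD, Nat.reduceAdd, pe_zero, pe_1, pe_2, pe_3, pe_4, pe_5, pe_6, pe_7, pe_8, pe_9, pe_10, pe_11] <;> ring_nf <;> positivity

lemma main_2 (t : ℝ) (ht : 0 < t) (a : ℕ) (ha : 4 ≤ a) : 0 < DD (2 + t) 2 a := by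
  induction a using Nat.strong_induction_on with
  | _ a ih =>
    rcases Nat.lt_or_ge a 9 with h1 | h1
    · interval_cases a
      · exact base_2_4 t ht
      · exact base_2_5 t ht
      · exact base_2_6 t ht
      · exact base_2_7 t ht
      · exact base_2_8 t ht
    obtain ⟨n, rfl⟩ : ∃ n, a = n + 1 := ⟨a - 1, by omega⟩
    rcases Nat.lt_or_ge n 9 with h2 | h2
    · apply DD_step (2 + t) (by linarith) 2 n (by omega) (E2 t) 92 (E2_nonneg t ht)
        (E2_le t ht) _ (fun j hj1 hj2 => ih j hj2 hj1)
      · have h3 : pe (2 + t) 8 ≤ pe (2 + t) n := pe_mono _ (by linarith) (by omega)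
        have h4 := mul_le_mul_of_nonneg_left h3 (pe_pos (2 + t) (by linarith) 3).le
        refine lt_of_lt_of_le ?_ h4
        rw [← sub_pos]
        simp only [Finset.sum_range_succ, Finset.sum_range_zero, E2, Nat.reduceAdd, pe_1, pe_2, pe_3, pe_4, pe_5, pe_6, pe_7, pe_8, pe_9, pe_10, pe_11]
        ring_nf
        positivity
      · intro k hk
        have h3 : ∀ k < 10, sg k ≤ 92 := by decide +kernel
        exact_mod_cast h3 k (by omega)
    · apply DD_step (2 + t) (by linarith) 2 n (by omega) (E2 t)
        (((n : ℝ) + 1) * (n + 2) / 2) (E2_nonneg t ht)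
        (E2_le t ht) _ (fun j hj1 hj2 => ih j hj2 hj1)
      · obtain ⟨s, rfl⟩ : ∃ s, n = s + 8 + 1 := ⟨n - 9, by omega⟩
        have h3 := pe_lower5 (2 + t) (by linarith) (s + 8)
        have h4 := mul_le_mul_of_nonneg_left h3 (pe_pos (2 + t) (by linarith) 3).le
        refine lt_of_lt_of_le ?_ h4
        have hs : (0 : ℝ) ≤ s := Nat.cast_nonneg s
        push_cast
        generalize (s : ℝ) = r at hs
        rw [← sub_pos]
        simp only [Finset.sum_range_succ, Finset.sum_range_zero, E2, Nat.reduceAdd, pe_1, pe_2, pe_3, pe_4, pe_5, pe_6, pe_7, pe_8, pe_9, pe_10, pe_11]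
        ring_nf
        positivity
      · intro k hk
        have h3 := sg_upper k
        have h5 : k * (k + 1) ≤ (n + 1) * (n + 2) := Nat.mul_le_mul hk (by omega)
        have h6 : ((2 * sg k : ℕ) : ℝ) ≤ (((n + 1) * (n + 2) : ℕ) : ℝ) := by
          exact_mod_cast h3.trans h5
        push_cast at h6
        linarith

lemma base_3_5 (t : ℝ) (ht : 0 < t) : 0 < DD (1 + t) 3 5 := by
  have h : DD (1 + t) 3 5 = 4 / 1 + 233 / 20 * t ^ 1 + 9289 / 720 * t ^ 2 + 1343 / 180 * t ^ 3 + 8489 / 2880 * t ^ 4 + 79 / 90 * t ^ 5 + 217 / 1440 * t ^ 6 + 1 / 90 * t ^ 7 + 1 / 2880 * t ^ 8 := by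
    simp only [DD, Nat.reduceAdd, pe_1, pe_2, pe_3, pe_4, pe_5, pe_6, pe_7, pe_8, pe_9, pe_10, pe_11]
    ring
  rw [h]
  positivity

lemma base_3_6 (t : ℝ) (ht : 0 < t) : 0 < DD (1 + t) 3 6 := by
  have h : DD (1 + t) 3 6 = 2 / 1 + 52 / 5 * t ^ 1 + 2969 / 144 * t ^ 2 + 8893 / 432 * t ^ 3 + 6659 / 576 * t ^ 4 + 11291 / 2880 * t ^ 5 + 235 / 288 * t ^ 6 + 3 / 32 * t ^ 7 + 1 / 192 * t ^ 8 + 1 / 8640 * t ^ 9 := by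
    simp only [DD, Nat.reduceAdd, pe_1, pe_2, pe_3, pe_4, pe_5, pe_6, pe_7, pe_8, pe_9, pe_10, pe_11]
    ring
  rw [h]
  positivity

lemma base_3_7 (t : ℝ) (ht : 0 < t) : 0 < DD (1 + t) 3 7 := by
  have h : DD (1 + t) 3 7 = 10 / 1 + 7673 / 210 * t ^ 1 + 143321 / 2520 * t ^ 2 + 103297 / 2016 * t ^ 3 + 60817 / 2016 * t ^ 4 + 22633 / 1920 * t ^ 5 + 1871 / 640 * t ^ 6 + 583 / 1344 * t ^ 7 + 145 / 4032 * t ^ 8 + 61 / 40320 * t ^ 9 + 1 / 40320 * t ^ 10 := by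
    simp only [DD, Nat.reduceAdd, pe_1, pe_2, pe_3, pe_4, pe_5, pe_6, pe_7, pe_8, pe_9, pe_10, pe_11]
    ring
  rw [h]
  positivity

lemma base_3_8 (t : ℝ) (ht : 0 < t) : 0 < DD (1 + t) 3 8 := by
  have h : DD (1 + t) 3 8 = 9 / 1 + 12351 / 280 * t ^ 1 + 180967 / 2016 * t ^ 2 + 6040109 / 60480 * t ^ 3 + 1637719 / 24192 * t ^ 4 + 7137017 / 241920 * t ^ 5 + 4823 / 576 * t ^ 6 + 121601 / 80640 * t ^ 7 + 1325 / 8064 * t ^ 8 + 2479 / 241920 * t ^ 9 + 1 / 3024 * t ^ 10 + 1 / 241920 * t ^ 11 := by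
    simp only [DD, Nat.reduceAdd, pe_1, pe_2, pe_3, pe_4, pe_5, pe_6, pe_7, pe_8, pe_9, pe_10, pe_11]
    ring
  rw [h]
  positivity

lemma base_3_9 (t : ℝ) (ht : 0 < t) : 0 < DD (1 + t) 3 9 := by
  have h : DD (1 + t) 3 9 = 20 / 1 + 7457 / 84 * t ^ 1 + 1037431 / 6048 * t ^ 2 + 4630615 / 24192 * t ^ 3 + 59663227 / 435456 * t ^ 4 + 18984151 / 290304 * t ^ 5 + 36345371 / 1741824 * t ^ 6 + 423149 / 96768 * t ^ 7 + 339821 / 580608 * t ^ 8 + 173 / 3584 * t ^ 9 + 4049 / 1741824 * t ^ 10 + 17 / 290304 * t ^ 11 + 1 / 1741824 * t ^ 12 := by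
    simp only [DD, Nat.reduceAdd, pe_1, pe_2, pe_3, pe_4, pe_5, pe_6, pe_7, pe_8, pe_9, pe_10, pe_11]
    ring
  rw [h]
  positivity

lemma base_3_10 (t : ℝ) (ht : 0 < t) : 0 < DD (1 + t) 3 10 := by
  have h : DD (1 + t) 3 10 = 24 / 1 + 305903 / 2520 * t ^ 1 + 3336869 / 12600 * t ^ 2 + 595999433 / 1814400 * t ^ 3 + 933877663 / 3628800 * t ^ 4 + 35958379 / 268800 * t ^ 5 + 682864349 / 14515200 * t ^ 6 + 162178697 / 14515200 * t ^ 7 + 8521307 / 4838400 * t ^ 8 + 2609753 / 14515200 * t ^ 9 + 167063 / 14515200 * t ^ 10 + 2113 / 4838400 * t ^ 11 + 127 / 14515200 * t ^ 12 + 1 / 14515200 * t ^ 13 := by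
    simp only [DD, Nat.reduceAdd, pe_1, pe_2, pe_3, pe_4, pe_5, pe_6, pe_7, pe_8, pe_9, pe_10, pe_11]
    ring
  rw [h]
  positivity

lemma base_3_11 (t : ℝ) (ht : 0 < t) : 0 < DD (1 + t) 3 11 := by
  have h : DD (1 + t) 3 11 = 42 / 1 + 162749 / 792 * t ^ 1 + 105548279 / 237600 * t ^ 2 + 160096621 / 285120 * t ^ 3 + 1576195591 / 3421440 * t ^ 4 + 159529823 / 622080 * t ^ 5 + 203960213 / 2073600 * t ^ 6 + 64663687 / 2488320 * t ^ 7 + 11659151 / 2488320 * t ^ 8 + 52321 / 92160 * t ^ 9 + 562867 / 12441600 * t ^ 10 + 62807 / 27371520 * t ^ 11 + 637 / 9123840 * t ^ 12 + 31 / 27371520 * t ^ 13 + 1 / 136857600 * t ^ 14 := by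
    simp only [DD, Nat.reduceAdd, pe_1, pe_2, pe_3, pe_4, pe_5, pe_6, pe_7, pe_8, pe_9, pe_10, pe_11]
    ring
  rw [h]
  positivity

/-- bound for the first differences -/
noncomputable def E3 (t : ℝ) : ℕ → ℝ
  | 0 => 3 / 1 + 29 / 6 * t ^ 1 + 2 / 1 * t ^ 2 + 1 / 6 * t ^ 3
  | 1 => 15 / 8 * t ^ 2 + 5 / 4 * t ^ 3 + 1 / 8 * t ^ 4
  | 2 => 1 / 1 + 37 / 12 * t ^ 1 + 85 / 24 * t ^ 2 + 15 / 8 * t ^ 3 + 11 / 24 * t ^ 4 + 1 / 24 * t ^ 5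
  | 3 => 17 / 72 * t ^ 2 + 25 / 16 * t ^ 3 + 109 / 144 * t ^ 4 + 5 / 48 * t ^ 5 + 1 / 144 * t ^ 6
  | _ => 0

lemma E3_nonneg (t : ℝ) (ht : 0 < t) (j : ℕ) (hj : j ≤ 3) : 0 ≤ E3 t j := by
  interval_cases j <;> simp only [E3] <;> positivity

lemma E3_le (t : ℝ) (ht : 0 < t) (j : ℕ) (hj : j ≤ 3) : - E3 t j ≤ DD (1 + t) 3 j := by
  rw [neg_le_iff_add_nonneg]
  interval_cases j <;> simp only [E3, DD, Nat.reduceAdd, pe_zero, pe_1, pe_2, pe_3, pe_4, pe_5, pe_6, pe_7, pe_8, pe_9, pe_10, pe_11] <;> ring_nf <;> positivity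

lemma main_3 (t : ℝ) (ht : 0 < t) (a : ℕ) (ha : 5 ≤ a) : 0 < DD (1 + t) 3 a := by
  induction a using Nat.strong_induction_on with
  | _ a ih =>
    rcases Nat.lt_or_ge a 12 with h1 | h1
    · interval_cases a
      · exact base_3_5 t ht
      · exact base_3_6 t ht
      · exact base_3_7 t ht
      · exact base_3_8 t ht
      · exact base_3_9 t ht
      · exact base_3_10 t ht
      · exact base_3_11 t ht
    obtain ⟨n, rfl⟩ : ∃ n, a = n + 1 := ⟨a - 1, by omega⟩
    rcases Nat.lt_or_ge n 29 with h2 | h2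
    · apply DD_step (1 + t) (by linarith) 3 n (by omega) (E3 t) 70 (E3_nonneg t ht)
        (E3_le t ht) _ (fun j hj1 hj2 => ih j hj2 hj1)
      · have h3 : pe (1 + t) 11 ≤ pe (1 + t) n := pe_mono _ (by linarith) (by omega)
        have h4 := mul_le_mul_of_nonneg_left h3 (pe_pos (1 + t) (by linarith) 4).le
        refine lt_of_lt_of_le ?_ h4
        rw [← sub_pos]
        simp only [Finset.sum_range_succ, Finset.sum_range_zero, E3, Nat.reduceAdd, pe_1, pe_2, pe_3, pe_4, pe_5, pe_6, pe_7, pe_8, pe_9, pe_10, pe_11]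
        ring_nf
        positivity
      · intro k hk
        have h3 : ∀ k < 30, sg k ≤ 70 := by decide +kernel
        exact_mod_cast h3 k (by omega)
    · apply DD_step (1 + t) (by linarith) 3 n (by omega) (E3 t)
        (((n : ℝ) + 1) * (n + 2) / 2) (E3_nonneg t ht)
        (E3_le t ht) _ (fun j hj1 hj2 => ih j hj2 hj1)
      · obtain ⟨s, rfl⟩ : ∃ s, n = s + 28 + 1 := ⟨n - 29, by omega⟩
        have h3 := pe_lower5 (1 + t) (by linarith) (s + 28)
        have h4 := mul_le_mul_of_nonneg_left h3 (pe_pos (1 + t) (by linarith) 4).le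
        refine lt_of_lt_of_le ?_ h4
        have hs : (0 : ℝ) ≤ s := Nat.cast_nonneg s
        push_cast
        generalize (s : ℝ) = r at hs
        rw [← sub_pos]
        simp only [Finset.sum_range_succ, Finset.sum_range_zero, E3, Nat.reduceAdd, pe_1, pe_2, pe_3, pe_4, pe_5, pe_6, pe_7, pe_8, pe_9, pe_10, pe_11]
        ring_nf
        positivity
      · intro k hk
        have h3 := sg_upper k
        have h5 : k * (k + 1) ≤ (n + 1) * (n + 2) := Nat.mul_le_mul hk (by omega)
        have h6 : ((2 * sg k : ℕ) : ℝ) ≤ (((n + 1) * (n + 2) : ℕ) : ℝ) := by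
          exact_mod_cast h3.trans h5
        push_cast at h6
        linarith

theorem stmt0 (b : ℕ) (hb : b = 1 ∨ b = 2 ∨ b = 3) (x₀ : ℝ)
    (hx₀ : x₀ = if Odd b then 1 else 2) (a : ℕ) (ha : b + 2 ≤ a)
    (x : ℝ) (hx : x₀ < x) :
    0 < (P (a - 1)).eval x * (P (b + 1)).eval x - (P a).eval x * (P b).eval x := by
  suffices h : 0 < DD x b a by
    obtain ⟨n, rfl⟩ : ∃ n, a = n + 1 := ⟨a - 1, by omega⟩
    simp only [DD, pe] at h
    rw [Nat.add_sub_cancel]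
    linarith
  rcases hb with rfl | rfl | rfl
  · rw [if_pos (by decide)] at hx₀
    have h := main_1 (x - 1) (by linarith) a ha
    rwa [add_sub_cancel] at h
  · rw [if_neg (by decide)] at hx₀
    have h := main_2 (x - 2) (by linarith) a ha
    rwa [add_sub_cancel] at h
  · rw [if_pos (by decide)] at hx₀
    have h := main_3 (x - 1) (by linarith) a ha
    rwa [add_sub_cancel] at h
end

section
/- Let a and b be positive integers with a > b+1. If b is odd or b ≥ 26, then p(a−1)·p(b+1) ≥ p(a)·p(b), i.e. Δ_{a,b}(1) ≥ 0. -/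
def p (n : ℕ) : ℕ := Fintype.card (Nat.Partition n)

open PowerSeries PowerSeries.WithPiTopology in
theorem PA_hasProd (R : Type*) [TopologicalSpace R] [T2Space R] [CommSemiring R] [IsTopologicalSemiring R] :
    HasProd (fun i : ℕ ↦ ∑' j : ℕ, (X : R⟦X⟧) ^ ((i + 1) * j)) (PowerSeries.mk fun n ↦ (p n : R)) := by
  have h := Nat.Partition.hasProd_powerSeriesMk_card_restricted R (fun _ => True)
  simpa [Nat.Partition.restricted, p] using h

open PowerSeries PowerSeries.WithPiTopology in
theorem PA_geom (R : Type*) [TopologicalSpace R] [T2Space R] [CommRing R] [IsTopologicalRing R] (i : ℕ) :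
    (∑' j : ℕ, (X : R⟦X⟧) ^ ((i + 1) * j)) * (1 - X ^ (i+1)) = 1 := by
  simp_rw [pow_mul]
  exact tsum_pow_mul_one_sub_of_constantCoeff_eq_zero (by simp)

open PowerSeries PowerSeries.WithPiTopology in
theorem PA_mul_pent : (PowerSeries.mk fun n ↦ (p n : ℤ)) * pentagonalSeries ℤ = 1 := by
  have h1 := (PA_hasProd ℤ).mul (hasProd_one_sub_X_pow ℤ)
  simp_rw [PA_geom ℤ] at h1
  exact h1.unique hasProd_one

noncomputable def EK (K : ℕ) : Polynomial ℤ :=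
  ∑ k ∈ Finset.range K, (-1) ^ k * (Polynomial.X ^ pentagonal (-k) - Polynomial.X ^ pentagonal (k + 1))

noncomputable def PM (M : ℕ) : Polynomial ℤ :=
  ∑ k ∈ Finset.range M, Polynomial.C (p k : ℤ) * Polynomial.X ^ k

open PowerSeries PowerSeries.WithPiTopology in
theorem PA_coeff_pent (K M : ℕ) (hM : 2 * M ≤ K * (3 * K + 1)) (n : ℕ) (hn : n < M) :
    coeff n (pentagonalSeries ℤ) = (EK K).coeff n := by
  have h := hasSum_pow_pentagonal_sub_pentagonalSeries ℤ
  have h2 : HasSum (fun k : ℕ => coeff n ((-1) ^ k * ((X:ℤ⟦X⟧) ^ pentagonal (-k) - X ^ pentagonal (k + 1)))) (coeff n (pentagonalSeries ℤ)) := h.map (coeff (R:=ℤ) n) (continuous_coeff ℤ n)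
  have h3 := hasSum_sum_of_ne_finset_zero (L := SummationFilter.unconditional ℕ) (f := fun k : ℕ => coeff n ((-1) ^ k * ((X:ℤ⟦X⟧) ^ pentagonal (-k) - X ^ pentagonal (k + 1)))) (s := Finset.range K) ?_
  · rw [h2.unique h3]
    simp only [EK, Polynomial.finset_sum_coeff]
    refine Finset.sum_congr rfl fun k _ => ?_
    rw [← Polynomial.coeff_coe]
    congr 1
    push_cast
    simp
  · intro k hk
    have hk' : K ≤ k := by simpa using hk
    have e1 : n < pentagonal (-k) := by
      have := two_mul_natCast_pentagonal_neg k
      zify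
      have : (K:ℤ) * (3 * K + 1) ≤ k * (3 * k + 1) := by
        have : (K:ℤ) ≤ k := by exact_mod_cast hk'
        gcongr
      have : 2 * (M:ℤ) ≤ K * (3 * K + 1) := by exact_mod_cast hM
      have : (n:ℤ) < M := by exact_mod_cast hn
      linarith
    have e2 : pentagonal (-k) < pentagonal (k+1) := pentagonal_neg_lt_pentagonal_add_one (by positivity)
    have : ((-1:ℤ⟦X⟧)) ^ k = C ((-1:ℤ)^k) := by simp
    rw [this, coeff_C_mul, map_sub, coeff_X_pow, coeff_X_pow, if_neg (by omega), if_neg (by omega)]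
    simp

theorem PA_dvd (K M : ℕ) (hM : 2 * M ≤ K * (3 * K + 1)) (hM0 : 0 < M):
    (Polynomial.X : Polynomial ℤ) ^ M ∣ PM M * EK K - 1 := by
  rw [Polynomial.X_pow_dvd_iff]
  intro n hn
  have h := congrArg (PowerSeries.coeff n) PA_mul_pent
  rw [PowerSeries.coeff_mul] at h
  rw [Polynomial.coeff_sub, Polynomial.coeff_mul, sub_eq_zero]
  have h1 : (1 : Polynomial ℤ).coeff n = PowerSeries.coeff n (1 : PowerSeries ℤ) := by
    rw [← Polynomial.coeff_coe]; simp
  rw [h1, ← h]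
  refine Finset.sum_congr rfl fun x hx => ?_
  have hx' := Finset.HasAntidiagonal.mem_antidiagonal.mp hx
  rw [PA_coeff_pent K M hM _ (by omega), PowerSeries.coeff_mk]
  congr 1
  simp only [PM, Polynomial.finset_sum_coeff, Polynomial.coeff_C_mul_X_pow]
  rw [Finset.sum_ite_eq]
  simp; omega

theorem PA_eval (K M Q : ℕ) (hM : 2 * M ≤ K * (3 * K + 1)) (hM0 : 0 < M) :
    ((Q : ℤ) ^ M) ∣ (∑ k ∈ Finset.range M, (p k : ℤ) * Q ^ k) *
      (∑ k ∈ Finset.range K, (-1) ^ k * ((Q:ℤ) ^ pentagonal (-k) - (Q:ℤ) ^ pentagonal (k + 1))) - 1 := by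
  have h := map_dvd (Polynomial.evalRingHom (Q:ℤ)) (PA_dvd K M hM hM0)
  simpa [PM, EK, Polynomial.eval_finset_sum] using h

/-- evaluate `x` before passing it on (kernel reduction helper) -/
def kforce {α : Type} (x : ℕ) (k : ℕ → α) : α := Nat.rec (k 0) (fun n _ => k (Nat.succ n)) x

theorem kforce_eq {α : Type} (x : ℕ) (k : ℕ → α) : kforce x k = k x := by
  cases x <;> rfl

/-- low `m` bits of `x` -/
def ktrunc (x m : ℕ) : ℕ := kforce x fun y => y - Nat.shiftLeft (Nat.shiftRight y m) m

theorem ktrunc_eq (x m : ℕ) : ktrunc x m = x % 2 ^ m := by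
  unfold ktrunc
  rw [kforce_eq]
  show x - (x >>> m) <<< m = _
  rw [Nat.shiftLeft_eq, Nat.shiftRight_eq_div_pow, Nat.mod_eq_sub_div_mul]

def kepos : ℕ → ℕ
  | 0 => 0
  | k + 1 => kepos k + Nat.shiftLeft 1 (512 * (if k % 2 = 0 then k * (3 * k + 1) / 2 else (k + 1) * (3 * k + 2) / 2))

def keneg : ℕ → ℕ
  | 0 => 0
  | k + 1 => keneg k + Nat.shiftLeft 1 (512 * (if k % 2 = 0 then (k + 1) * (3 * k + 2) / 2 else k * (3 * k + 1) / 2))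

def knewton (e : ℕ) : ℕ → ℕ
  | 0 => 1
  | i + 1 => kforce (knewton e i) fun y => kforce (512 * 2 ^ (i + 1)) fun m =>
      ktrunc (y * (Nat.shiftLeft 1 m + 2 - ktrunc (ktrunc e m * y) m)) m

def kdigits : ℕ → ℕ → List ℕ → List ℕ
  | 0, x, tl => kforce x fun y => y :: tl
  | d + 1, x, tl => kforce x fun y => kforce (512 * 2 ^ d) fun m => kforce (Nat.shiftRight y m) fun hi =>
      kdigits d (y - Nat.shiftLeft hi m) (kdigits d hi tl)

def klogc : List ℕ → Bool
  | a :: b :: c :: l => Nat.ble (a * c) (b * b) && klogc (b :: c :: l)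
  | _ => true

def ksmall (l : List ℕ) : Bool :=
  (List.range 13).all fun i => (List.range 28).all fun a =>
    Nat.ble a (2 * i + 2) || Nat.ble (l.getD a 0 * l.getD (2 * i + 1) 0) (l.getD (a - 1) 0 * l.getD (2 * i + 2) 0)

def kverify (ep en x D : ℕ) : Bool :=
  Nat.beq (ktrunc (x * ep) (512 * 2 ^ D)) (ktrunc (x * en + 1) (512 * 2 ^ D))

def kcheck (K D : ℕ) : Bool :=
  kforce (kepos K) fun ep => kforce (keneg K) fun en =>
  kforce (knewton (ep + Nat.shiftLeft 1 (512 * 2 ^ (D + 1)) - en) D) fun x =>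
   kverify ep en x D && ksmall (kdigits D x []) && klogc ((kdigits D x []).drop 25)
 
theorem kcheck_true : kcheck 105 14 = true := by decide +kernel

theorem kdigits_length (d x : ℕ) (tl : List ℕ) : (kdigits d x tl).length = 2 ^ d + tl.length := by
  induction d generalizing x tl with
  | zero => simp [kdigits, kforce_eq]; omega
  | succ d ih => simp only [kdigits, kforce_eq, ih]; ring

theorem kdigits_spec (d x : ℕ) (tl : List ℕ) (hx : x < (2 ^ 512) ^ 2 ^ d) :
    ∃ l : List ℕ, kdigits d x tl = l ++ tl ∧ l.length = 2 ^ d ∧ (∀ a ∈ l, a < 2 ^ 512) ∧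
      Nat.ofDigits (2 ^ 512) l = x := by
  induction d generalizing x tl with
  | zero => exact ⟨[x], by simp [kdigits, kforce_eq], by simp, by simpa using hx, by simp⟩
  | succ d ih =>
    simp only [kdigits, kforce_eq]
    have e1 : Nat.shiftRight x (512 * 2 ^ d) = x / (2 ^ 512) ^ 2 ^ d := by
      rw [← pow_mul]; exact Nat.shiftRight_eq_div_pow _ _
    have e2 : x - Nat.shiftLeft (Nat.shiftRight x (512 * 2 ^ d)) (512 * 2 ^ d) = x % (2 ^ 512) ^ 2 ^ d := by
      rw [e1]
      show x - (x / (2 ^ 512) ^ 2 ^ d) <<< (512 * 2 ^ d) = _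
      rw [Nat.shiftLeft_eq, pow_mul, Nat.mod_eq_sub_div_mul]
    rw [e2, e1]
    have hpos : 0 < (2 ^ 512) ^ 2 ^ d := by positivity
    obtain ⟨l2, h21, h22, h23, h24⟩ := ih (x / (2 ^ 512) ^ 2 ^ d) tl (by
      rw [Nat.div_lt_iff_lt_mul hpos, ← pow_add]
      calc x < _ := hx
        _ = _ := by rw [pow_succ 2 d, mul_two])
    obtain ⟨l1, h11, h12, h13, h14⟩ := ih (x % (2 ^ 512) ^ 2 ^ d) (kdigits d (x / (2 ^ 512) ^ 2 ^ d) tl)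
      (Nat.mod_lt _ hpos)
    refine ⟨l1 ++ l2, by rw [h11, h21, List.append_assoc], by simp [h12, h22]; ring, ?_, ?_⟩
    · intro a ha
      rcases List.mem_append.mp ha with h | h
      · exact h13 a h
      · exact h23 a h
    · rw [Nat.ofDigits_append, h14, h24, h12, Nat.mod_add_div]

theorem kepos_sub (K : ℕ) : (kepos K : ℤ) - keneg K =
    ∑ k ∈ Finset.range K, (-1) ^ k * (((2 ^ 512 : ℕ):ℤ) ^ pentagonal (-k) - ((2 ^ 512 : ℕ):ℤ) ^ pentagonal (k + 1)) := by
  induction K with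
  | zero => rw [Finset.range_zero, Finset.sum_empty]; rfl
  | succ k ih =>
    rw [Finset.sum_range_succ, ← ih]
    have a1 : pentagonal (-k) = k * (3 * k + 1) / 2 := by
      have := two_mul_natCast_pentagonal_neg k
      have h : 2 * pentagonal (-k) = k * (3 * k + 1) := by exact_mod_cast this
      omega
    have a2 : pentagonal (k + 1) = (k + 1) * (3 * k + 2) / 2 := by
      have := two_mul_natCast_pentagonal (k+1)
      have h : 2 * pentagonal (k+1) = (k+1) * (3 * k + 2) := by
        zify; rw [this]; ring
      omega
    have sl : ∀ n, Nat.shiftLeft 1 (512 * n) = (2 ^ 512) ^ n := by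
      intro n; rw [← pow_mul]; exact Nat.one_shiftLeft _
    simp only [kepos, keneg, sl, a1, a2]
    rcases Nat.mod_two_eq_zero_or_one k with h | h
    · rw [if_pos h, if_pos h, Even.neg_one_pow (Nat.even_iff.mpr h)]; push_cast; ring
    · rw [if_neg (by omega), if_neg (by omega), Odd.neg_one_pow (Nat.odd_iff.mpr h)]; push_cast; ring

theorem klogc_spec (l : List ℕ) (h : klogc l = true) (i : ℕ) (hi : i + 2 < l.length) :
    l.getD i 0 * l.getD (i + 2) 0 ≤ l.getD (i + 1) 0 ^ 2 := by
  induction l generalizing i with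
  | nil => simp at hi
  | cons a l ih =>
    match l, ih with
    | [], _ => simp at hi
    | [b], _ => simp at hi
    | b :: c :: l, ih =>
      simp only [klogc, Bool.and_eq_true, Nat.ble_eq] at h
      cases i with
      | zero => simpa [sq] using h.1
      | succ i => simpa using ih h.2 i (by simpa using hi)

theorem kverify_eq (ep en x D : ℕ) (h : kverify ep en x D = true) :
    ((2 ^ 512 : ℕ) : ℤ) ^ 2 ^ D ∣ (x : ℤ) * (ep - en) - 1 := by
  have h := Nat.eq_of_beq_eq_true h
  rw [ktrunc_eq, ktrunc_eq] at h
  have h2 : (x * en + 1) ≡ (x * ep) [MOD 2 ^ (512 * 2 ^ D)] := h.symm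
  rw [Nat.modEq_iff_dvd] at h2
  push_cast at h2 ⊢
  rw [← pow_mul]
  convert h2 using 1
  ring

theorem kdigits_eq (K D x : ℕ) (hK : 2 * 2 ^ D ≤ K * (3 * K + 1))
    (hv : kverify (kepos K) (keneg K) x D = true) (hx : x < (2 ^ 512) ^ 2 ^ D)
    (hp : ∀ n < 2 ^ D, p n < 2 ^ 512) (n : ℕ) (hn : n < 2 ^ D) :
    (kdigits D x []).getD n 0 = p n := by
  obtain ⟨l, h1, h2, h3, h4⟩ := kdigits_spec D x [] hx
  have hd := kverify_eq _ _ _ _ hv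
  rw [kepos_sub] at hd
  have hP := PA_eval K (2 ^ D) (2 ^ 512) hK (by positivity)
  set S : ℤ := ∑ k ∈ Finset.range K, (-1) ^ k * (((2 ^ 512 : ℕ):ℤ) ^ pentagonal (-k) - ((2 ^ 512 : ℕ):ℤ) ^ pentagonal (k + 1)) with hS
  set W : ℕ := ∑ k ∈ Finset.range (2 ^ D), p k * (2 ^ 512) ^ k with hW
  have hWc : (∑ k ∈ Finset.range (2 ^ D), (p k : ℤ) * ((2 ^ 512 : ℕ) : ℤ) ^ k) = W := by
    rw [hW]; push_cast; rfl
  rw [hWc] at hP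
  have key : ((2 ^ 512 : ℕ) : ℤ) ^ 2 ^ D ∣ (W : ℤ) - x := by
    have e : (W : ℤ) - x = x * (W * S - 1) - W * (x * S - 1) := by ring
    rw [e]
    exact dvd_sub (Dvd.dvd.mul_left hP _) (Dvd.dvd.mul_left hd _)
  set P : List ℕ := (List.range (2 ^ D)).map p with hPdef
  have hof : ∀ m : ℕ, Nat.ofDigits (2 ^ 512) ((List.range m).map p) = ∑ k ∈ Finset.range m, p k * (2 ^ 512) ^ k := by
    intro m
    induction m with
    | zero => simp
    | succ m ih => rw [List.range_succ, List.map_append, Nat.ofDigits_append, ih, Finset.sum_range_succ]; simp [mul_comm]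
  have hPd : ∀ a ∈ P, a < 2 ^ 512 := by
    intro a ha
    simp only [hPdef, List.mem_map, List.mem_range] at ha
    obtain ⟨m, hm, rfl⟩ := ha
    exact hp m hm
  have hPlen : P.length = 2 ^ D := by simp [hPdef]
  have hWlt : W < (2 ^ 512) ^ 2 ^ D := by
    have := Nat.ofDigits_lt_base_pow_length (b := 2 ^ 512) (l := P) (by norm_num) hPd
    rwa [hPlen, hof] at this
  have hWx : W = x := by
    have h5 : x ≡ W [MOD (2 ^ 512) ^ 2 ^ D] := by
      rw [Nat.modEq_iff_dvd]; exact_mod_cast key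
    have := Nat.ModEq.eq_of_lt_of_lt h5 hx hWlt
    exact this.symm
  have hPl : P = l := by
    apply Nat.ofDigits_inj_of_len_eq (b := 2 ^ 512) (by norm_num) (by rw [hPlen, h2]) hPd h3
    rw [h4, hof, ← hW, hWx]
  rw [h1, List.append_nil, ← hPl, hPdef]
  simp [List.getD, hn]

theorem knewton_lt (e D : ℕ) : knewton e D < (2 ^ 512) ^ 2 ^ D := by
  rw [← pow_mul]
  cases D with
  | zero => simp [knewton]
  | succ D => simp only [knewton, kforce_eq, ktrunc_eq]; exact Nat.mod_lt _ (by positivity)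

theorem kcheck_sound (K D : ℕ) (hK : 2 * 2 ^ D ≤ K * (3 * K + 1)) (hD : 5 ≤ D)
    (hp : ∀ n < 2 ^ D, p n < 2 ^ 512) (hc : kcheck K D = true) :
    (∀ n, 26 ≤ n → n + 1 < 2 ^ D → p (n - 1) * p (n + 1) ≤ p n ^ 2) ∧
    (∀ b < 26, Odd b → ∀ a < 28, b + 1 < a → p a * p b ≤ p (a - 1) * p (b + 1)) := by
  simp only [kcheck, kforce_eq, Bool.and_eq_true] at hc
  obtain ⟨⟨hv, hs⟩, hl⟩ := hc
  have hx := knewton_lt (kepos K + Nat.shiftLeft 1 (512 * 2 ^ (D + 1)) - keneg K) D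
  have hd := kdigits_eq K D _ hK hv hx hp
  have hlen := kdigits_length D (knewton (kepos K + Nat.shiftLeft 1 (512 * 2 ^ (D + 1)) - keneg K) D) []
  set l := kdigits D (knewton (kepos K + Nat.shiftLeft 1 (512 * 2 ^ (D + 1)) - keneg K) D) []
  have h32 : 2 ^ 5 ≤ 2 ^ D := Nat.pow_le_pow_right (by norm_num) hD
  constructor
  · intro n hn hn2
    have h := klogc_spec _ hl (n - 26) (by rw [List.length_drop, hlen]; simp; omega)
    have hg : ∀ i, (l.drop 25).getD i 0 = l.getD (25 + i) 0 := by
      intro i; simp [List.getD, List.getElem?_drop]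
    rw [hg, hg, hg, hd _ (by omega), hd _ (by omega), hd _ (by omega)] at h
    have e1 : 25 + (n - 26) = n - 1 := by omega
    have e2 : 25 + (n - 26 + 2) = n + 1 := by omega
    have e3 : 25 + (n - 26 + 1) = n := by omega
    rwa [e1, e2, e3] at h
  · intro b hb hob a ha hab
    obtain ⟨i, rfl⟩ := hob
    simp only [ksmall, List.all_eq_true, List.mem_range, Bool.or_eq_true, Nat.ble_eq] at hs
    have h := (hs i (by omega) a ha).resolve_left (by omega)
    rwa [hd _ (by omega), hd _ (by omega), hd _ (by omega), hd _ (by omega)] at h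

open PowerSeries PowerSeries.WithPiTopology in
theorem PD_geom (i : ℕ) : (∑' j : ℕ, (X : ℝ⟦X⟧) ^ ((i + 1) * j)) = PowerSeries.mk fun n => if (i + 1) ∣ n then (1:ℝ) else 0 := by
  have hs : Summable fun j : ℕ => (X : ℝ⟦X⟧) ^ ((i + 1) * j) := by
    simp_rw [pow_mul]
    exact summable_pow_of_constantCoeff_eq_zero (by simp)
  ext n
  have h : HasSum (fun j : ℕ => coeff n ((X : ℝ⟦X⟧) ^ ((i + 1) * j))) (coeff n (∑' j : ℕ, (X : ℝ⟦X⟧) ^ ((i + 1) * j))) := 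
    hs.hasSum.map (coeff (R:=ℝ) n) (continuous_coeff ℝ n)
  rw [coeff_mk]
  refine h.unique ?_
  simp_rw [coeff_X_pow]
  split_ifs with hd
  · obtain ⟨j, rfl⟩ := hd
    convert hasSum_ite_eq j (1:ℝ) using 2 with k
    simp [eq_comm]
  · convert hasSum_zero using 2 with k
    rw [if_neg]
    rintro rfl
    exact hd (dvd_mul_right _ _)

/-- coefficients of the truncated product -/
noncomputable def PDa (K n : ℕ) : ℝ :=
  PowerSeries.coeff n (∏ i ∈ Finset.range K, PowerSeries.mk fun n => if (i + 1) ∣ n then (1:ℝ) else 0)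

theorem PDa_succ (K n : ℕ) : PDa (K + 1) n =
    ∑ x ∈ Finset.HasAntidiagonal.antidiagonal n, PDa K x.1 * (if (K + 1) ∣ x.2 then (1:ℝ) else 0) := by
  simp only [PDa, Finset.prod_range_succ, PowerSeries.coeff_mul, PowerSeries.coeff_mk]

theorem PDa_nonneg (K n : ℕ) : 0 ≤ PDa K n := by
  induction K generalizing n with
  | zero => simp only [PDa, Finset.range_zero, Finset.prod_empty, PowerSeries.coeff_one]; split_ifs <;> norm_num
  | succ K ih =>
    rw [PDa_succ]
    exact Finset.sum_nonneg fun x _ => mul_nonneg (ih _) (by split_ifs <;> norm_num)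

theorem PDa_mono (K n : ℕ) : PDa K n ≤ PDa (K + 1) n := by
  rw [PDa_succ]
  have := Finset.single_le_sum (f := fun x : ℕ × ℕ => PDa K x.1 * (if (K + 1) ∣ x.2 then (1:ℝ) else 0))
    (s := Finset.HasAntidiagonal.antidiagonal n) (fun x _ => mul_nonneg (PDa_nonneg _ _) (by split_ifs <;> norm_num))
    (a := (n, 0)) (by simp)
  simpa using this

open PowerSeries PowerSeries.WithPiTopology Filter Topology in
theorem PDa_tendsto (n : ℕ) : Tendsto (fun K => PDa K n) atTop (𝓝 (p n : ℝ)) := by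
  have h := (PA_hasProd ℝ).tendsto_prod_nat
  have h2 := ((continuous_coeff ℝ n).tendsto _).comp h
  simp only [PD_geom] at h2
  simpa [Function.comp_def, PDa] using h2

theorem PDa_le (K n : ℕ) : PDa K n ≤ p n :=
  (monotone_nat_of_le_succ fun K => PDa_mono K n).ge_of_tendsto (PDa_tendsto n) K

theorem PD_geom_sum (q : ℂ) (hq : ‖q‖ < 1) (s : ℕ) (hs : 0 < s) :
    HasSum (fun n : ℕ => ((if s ∣ n then (1:ℝ) else 0 : ℝ) : ℂ) * q ^ n) (1 - q ^ s)⁻¹ := by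
  have h := hasSum_geometric_of_norm_lt_one (ξ := q ^ s) (by rw [norm_pow]; exact pow_lt_one₀ (norm_nonneg _) hq hs.ne')
  have hi : Function.Injective (fun j : ℕ => s * j) := fun a b hab => Nat.eq_of_mul_eq_mul_left hs hab
  rw [← hi.hasSum_iff]
  · have e : ((fun n : ℕ => ((if s ∣ n then (1:ℝ) else 0 : ℝ) : ℂ) * q ^ n) ∘ fun j : ℕ => s * j) = fun j => (q ^ s) ^ j := by
      ext j
      simp [Function.comp_apply, pow_mul]
    rw [e]; exact h
  · intro x hx
    rw [if_neg]; · simp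
    rintro ⟨j, rfl⟩
    exact hx ⟨j, rfl⟩

theorem PD_cauchy (f g h : ℕ → ℂ) (hf : Summable fun n => ‖f n‖) (hg : Summable fun n => ‖g n‖)
    (e : ∀ n, h n = ∑ x ∈ Finset.HasAntidiagonal.antidiagonal n, f x.1 * g x.2) :
    Summable (fun n => ‖h n‖) ∧ ∑' n, h n = (∑' n, f n) * ∑' n, g n := by
  obtain rfl : h = _ := funext e
  exact ⟨summable_norm_sum_mul_antidiagonal_of_summable_norm hf hg,
    (tsum_mul_tsum_eq_tsum_sum_antidiagonal_of_summable_norm hf hg).symm⟩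

theorem PDa_sum (q : ℂ) (hq : ‖q‖ < 1) (K : ℕ) :
    Summable (fun n => ‖(PDa K n : ℂ) * q ^ n‖) ∧
    ∑' n, (PDa K n : ℂ) * q ^ n = ∏ i ∈ Finset.range K, (1 - q ^ (i + 1))⁻¹ := by
  induction K with
  | zero =>
    have : (fun n => (PDa 0 n : ℂ) * q ^ n) = fun n => if n = 0 then 1 else 0 := by
      ext n
      simp only [PDa, Finset.range_zero, Finset.prod_empty, PowerSeries.coeff_one]
      split_ifs with h <;> simp [h]
    constructor
    · have h2 : (fun n => ‖(PDa 0 n : ℂ) * q ^ n‖) = fun n => if n = 0 then 1 else 0 := by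
        ext n; rw [congrFun this n]; split_ifs <;> simp
      rw [h2]; exact (hasSum_ite_eq 0 (1:ℝ)).summable
    · rw [this]; simp
  | succ K ih =>
    have hb : Summable fun n : ℕ => ‖((if (K+1) ∣ n then (1:ℝ) else 0 : ℝ) : ℂ) * q ^ n‖ := by
      refine Summable.of_nonneg_of_le (fun _ => norm_nonneg _) (fun n => ?_) (summable_geometric_of_lt_one (norm_nonneg q) hq)
      rw [norm_mul, norm_pow]
      split_ifs <;> simp
    have e : ∀ n, (PDa (K+1) n : ℂ) * q ^ n = ∑ x ∈ Finset.HasAntidiagonal.antidiagonal n, ((PDa K x.1 : ℂ) * q ^ x.1) *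
        (((if (K+1) ∣ x.2 then (1:ℝ) else 0 : ℝ) : ℂ) * q ^ x.2) := by
      intro n
      rw [PDa_succ, Complex.ofReal_sum, Finset.sum_mul]
      refine Finset.sum_congr rfl fun x hx => ?_
      rw [← Finset.HasAntidiagonal.mem_antidiagonal.mp hx, pow_add]
      push_cast
      ring
    have hG := (PD_geom_sum q hq (K+1) (by omega)).tsum_eq
    obtain ⟨i1, i2⟩ := ih
    rw [Finset.prod_range_succ, ← i2, ← hG]
    exact PD_cauchy _ _ _ i1 hb e

/-- the logarithm of the generating function -/
noncomputable def PL (q : ℂ) : ℂ := ∑' x : ℕ × ℕ, q ^ ((x.1 + 1) * (x.2 + 1)) / ((x.1 : ℂ) + 1)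

theorem PL_summable_real (r : ℝ) (h0 : 0 ≤ r) (h1 : r < 1) :
    Summable fun x : ℕ × ℕ => r ^ ((x.1 + 1) * (x.2 + 1)) := by
  have hr : √r < 1 := by rw [Real.sqrt_lt' one_pos]; simpa using h1
  have hg := summable_geometric_of_lt_one (Real.sqrt_nonneg r) hr
  have h := hg.mul_of_nonneg hg (fun _ => by positivity) (fun _ => by positivity)
  refine Summable.of_nonneg_of_le (fun _ => by positivity) (fun x => ?_) h
  have : r = √r ^ 2 := (Real.sq_sqrt h0).symm
  conv_lhs => rw [this]
  rw [← pow_mul, ← pow_add]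
  apply pow_le_pow_of_le_one (Real.sqrt_nonneg r) hr.le
  nlinarith

theorem PL_summable (q : ℂ) (hq : ‖q‖ < 1) :
    Summable fun x : ℕ × ℕ => q ^ ((x.1 + 1) * (x.2 + 1)) / ((x.1 : ℂ) + 1) := by
  refine Summable.of_norm_bounded (PL_summable_real ‖q‖ (norm_nonneg _) hq) fun x => ?_
  rw [norm_div, norm_pow]
  have : ‖(x.1:ℂ) + 1‖ = x.1 + 1 := by
    have : (x.1:ℂ) + 1 = ((x.1 + 1 : ℕ) : ℂ) := by push_cast; rfl
    rw [this, Complex.norm_natCast]; push_cast; rfl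
  rw [this]
  apply div_le_self (by positivity)
  linarith [Nat.cast_nonneg (α := ℝ) x.1]

open Filter Topology in
theorem PL_tendsto (q : ℂ) (hq : ‖q‖ < 1) :
    Tendsto (fun K => ∏ i ∈ Finset.range K, (1 - q ^ (i + 1))⁻¹) atTop (𝓝 (Complex.exp (PL q))) := by
  have hs := (PL_summable q hq)
  have hin : ∀ d : ℕ, HasSum (fun j : ℕ => q ^ ((j + 1) * (d + 1)) / ((j : ℂ) + 1)) (-Complex.log (1 - q ^ (d+1))) := by
    intro d
    have h := Complex.hasSum_taylorSeries_neg_log (z := q ^ (d + 1)) (by rw [norm_pow]; exact pow_lt_one₀ (norm_nonneg _) hq (by omega))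
    rw [← hasSum_nat_add_iff' 1] at h
    simp only [Finset.range_one, Finset.sum_singleton, pow_zero, Nat.cast_zero, div_zero, sub_zero] at h
    have e : (fun j : ℕ => q ^ ((j + 1) * (d + 1)) / ((j : ℂ) + 1)) = fun j => (q ^ (d + 1)) ^ (j + 1) / ((j + 1 : ℕ) : ℂ) := by
      ext j
      rw [← pow_mul, mul_comm]; push_cast; rfl
    rw [e]; exact h
  have h3 := (Equiv.hasSum_iff (Equiv.prodComm ℕ ℕ)).mpr hs.hasSum
  have h4 := h3.prod_fiberwise (f := fun x : ℕ × ℕ => q ^ ((x.2 + 1) * (x.1 + 1)) / ((x.2 : ℂ) + 1)) hin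
  have h5 := (Complex.continuous_exp.tendsto _).comp h4.tendsto_sum_nat
  refine h5.congr fun K => ?_
  rw [Function.comp_apply, Complex.exp_sum]
  refine Finset.prod_congr rfl fun d _ => ?_
  have hne : 1 - q ^ (d+1) ≠ 0 := by
    intro h
    have h1 : ‖q ^ (d+1)‖ < 1 := by rw [norm_pow]; exact pow_lt_one₀ (norm_nonneg _) hq (by omega)
    rw [← sub_eq_zero.mp h] at h1
    simp at h1
  rw [Complex.exp_neg, Complex.exp_log hne]

open Filter Topology in
theorem PD_summable_real (r : ℝ) (h0 : 0 ≤ r) (h1 : r < 1) : Summable fun n => (p n : ℝ) * r ^ n := by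
  have hq : ‖(r:ℂ)‖ < 1 := by simpa [abs_of_nonneg h0] using h1
  have ht := (continuous_norm.tendsto _).comp (PL_tendsto (r:ℂ) hq)
  refine summable_of_sum_range_le (c := ‖Complex.exp (PL r)‖) (fun n => by positivity) fun M => ?_
  have hl : Tendsto (fun K => ∑ n ∈ Finset.range M, PDa K n * r ^ n) atTop (𝓝 (∑ n ∈ Finset.range M, (p n : ℝ) * r ^ n)) :=
    tendsto_finset_sum _ fun n _ => (PDa_tendsto n).mul_const _
  refine le_of_tendsto_of_tendsto' hl ht fun K => ?_
  rw [Function.comp_apply, ← (PDa_sum (r:ℂ) hq K).2]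
  have hsum := (PDa_sum (r:ℂ) hq K).1
  have e : ∀ n, ‖(PDa K n : ℂ) * (r:ℂ) ^ n‖ = PDa K n * r ^ n := by
    intro n
    rw [norm_mul, norm_pow, Complex.norm_real, Complex.norm_real, Real.norm_of_nonneg (PDa_nonneg _ _), Real.norm_of_nonneg h0]
  simp_rw [e] at hsum
  have e2 : (∑' n, (PDa K n : ℂ) * (r:ℂ) ^ n) = ((∑' n, PDa K n * r ^ n : ℝ) : ℂ) := by
    push_cast; rfl
  rw [e2, Complex.norm_real]
  refine le_trans ?_ (le_abs_self _)
  exact hsum.sum_le_tsum _ fun n _ => mul_nonneg (PDa_nonneg _ _) (by positivity)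

open Filter Topology in
theorem PD_hasSum (q : ℂ) (hq : ‖q‖ < 1) : HasSum (fun n => (p n : ℂ) * q ^ n) (Complex.exp (PL q)) := by
  have hb := PD_summable_real ‖q‖ (norm_nonneg _) hq
  have hs : Summable fun n => (p n : ℂ) * q ^ n :=
    Summable.of_norm_bounded hb fun n => by rw [norm_mul, norm_pow, Complex.norm_natCast]
  have ht : Tendsto (fun K => ∑' n, (PDa K n : ℂ) * q ^ n) atTop (𝓝 (∑' n, (p n : ℂ) * q ^ n)) := by
    refine tendsto_tsum_of_dominated_convergence hb (fun n => ?_) (Eventually.of_forall fun K n => ?_)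
    · have := (Complex.continuous_ofReal.tendsto _).comp (PDa_tendsto n)
      simpa using this.mul_const (q ^ n)
    · rw [norm_mul, norm_pow, Complex.norm_real, Real.norm_of_nonneg (PDa_nonneg _ _)]
      gcongr
      exact PDa_le K n
  simp_rw [fun K => (PDa_sum q hq K).2] at ht
  rw [tendsto_nhds_unique (PL_tendsto q hq) ht]
  exact hs.hasSum

theorem PE_zeta : HasSum (fun j : ℕ => 1 / ((j:ℝ) + 1) ^ 2) (Real.pi ^ 2 / 6) := by
  have h := hasSum_zeta_two
  rw [← hasSum_nat_add_iff' 1] at h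
  simpa using h

theorem PE_prod (f : ℕ × ℕ → ℝ) (g : ℕ → ℝ) (C : ℝ) (hf : ∀ x, 0 ≤ f x)
    (hg : ∀ j, HasSum (fun d => f (j, d)) (g j)) (hC : ∀ j : ℕ, g j ≤ C * (1 / ((j:ℝ) + 1) ^ 2)) :
    Summable f ∧ ∑' x, f x ≤ C * (Real.pi ^ 2 / 6) := by
  have hg0 : ∀ j, 0 ≤ g j := fun j => (hg j).nonneg fun d => hf _
  have hs : Summable g := Summable.of_nonneg_of_le hg0 hC (PE_zeta.summable.mul_left C)
  have hsf : Summable f := by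
    rw [summable_prod_of_nonneg hf]
    exact ⟨fun j => (hg j).summable, by simpa only [(hg _).tsum_eq] using hs⟩
  refine ⟨hsf, ?_⟩
  rw [hsf.tsum_prod' fun j => (hg j).summable]
  simp only [(hg _).tsum_eq]
  rw [← (PE_zeta.mul_left C).tsum_eq]
  exact hs.tsum_le_tsum hC (PE_zeta.summable.mul_left C)

theorem PE_g0 (ρ : ℝ) (h0 : 0 < ρ) (h1 : ρ < 1) : HasSum (fun d : ℕ => ρ ^ (d + 1)) (ρ / (1 - ρ)) := by
  have h := (hasSum_geometric_of_lt_one h0.le h1).mul_left ρ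
  simpa [pow_succ', div_eq_mul_inv] using h

theorem PE_g1 (ρ : ℝ) (h0 : 0 < ρ) (h1 : ρ < 1) :
    HasSum (fun d : ℕ => ((d:ℝ) + 1) * ρ ^ (d + 1)) (ρ / (1 - ρ) ^ 2) := by
  have hn : ‖ρ‖ < 1 := by rwa [Real.norm_of_nonneg h0.le]
  have h := (hasSum_choose_mul_geometric_of_norm_lt_one 1 hn).mul_left ρ
  have e : (fun d : ℕ => ((d:ℝ) + 1) * ρ ^ (d + 1)) = fun d => ρ * (((d + 1).choose 1 : ℕ) * ρ ^ d) := by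
    ext d; rw [Nat.choose_one_right]; push_cast; ring
  have e2 : ρ / (1 - ρ) ^ 2 = ρ * (1 / (1 - ρ) ^ (1 + 1)) := by rw [mul_one_div]
  rw [e, e2]; exact h

theorem PE_c2 (d : ℕ) : (((d + 2).choose 2 : ℕ) : ℝ) = (d + 2) * (d + 1) / 2 := by
  rw [Nat.cast_choose_two]; push_cast; ring

theorem PE_c3 (d : ℕ) : (((d + 3).choose 3 : ℕ) : ℝ) = (d + 3) * (d + 2) * (d + 1) / 6 := by
  have h := Nat.add_one_mul_choose_eq (d + 2) 2
  have h2 : ((d + 2 + 1 : ℕ) : ℝ) * ((d + 2).choose 2 : ℕ) = ((d + 3).choose 3 : ℕ) * ((2 + 1 : ℕ) : ℝ) := by exact_mod_cast h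
  rw [PE_c2] at h2
  push_cast at h2
  linarith

theorem PE_g2 (ρ : ℝ) (h0 : 0 < ρ) (h1 : ρ < 1) :
    HasSum (fun d : ℕ => ((d:ℝ) + 1) ^ 2 * ρ ^ (d + 1)) (ρ * (1 + ρ) / (1 - ρ) ^ 3) := by
  have hn : ‖ρ‖ < 1 := by rwa [Real.norm_of_nonneg h0.le]
  have h := ((hasSum_choose_mul_geometric_of_norm_lt_one 2 hn).mul_left (2 * ρ)).sub (PE_g1 ρ h0 h1)
  have hne : 1 - ρ ≠ 0 := by linarith
  have e1 : (fun d : ℕ => ((d:ℝ) + 1) ^ 2 * ρ ^ (d + 1)) =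
      fun b : ℕ => 2 * ρ * (((b + 2).choose 2 : ℕ) * ρ ^ b) - ((b:ℝ) + 1) * ρ ^ (b + 1) := by
    ext d; rw [PE_c2]; ring
  have e2 : ρ * (1 + ρ) / (1 - ρ) ^ 3 = 2 * ρ * (1 / (1 - ρ) ^ (2 + 1)) - ρ / (1 - ρ) ^ 2 := by
    field_simp; ring
  rw [e1, e2]; exact h

theorem PE_g3 (ρ : ℝ) (h0 : 0 < ρ) (h1 : ρ < 1) :
    HasSum (fun d : ℕ => ((d:ℝ) + 1) ^ 3 * ρ ^ (d + 1)) (ρ * (1 + 4 * ρ + ρ ^ 2) / (1 - ρ) ^ 4) := by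
  have hn : ‖ρ‖ < 1 := by rwa [Real.norm_of_nonneg h0.le]
  have h := (((hasSum_choose_mul_geometric_of_norm_lt_one 3 hn).mul_left (6 * ρ)).sub
    ((hasSum_choose_mul_geometric_of_norm_lt_one 2 hn).mul_left (6 * ρ))).add (PE_g1 ρ h0 h1)
  have hne : 1 - ρ ≠ 0 := by linarith
  have e1 : (fun d : ℕ => ((d:ℝ) + 1) ^ 3 * ρ ^ (d + 1)) =
      fun b : ℕ => 6 * ρ * (((b + 3).choose 3 : ℕ) * ρ ^ b) - 6 * ρ * (((b + 2).choose 2 : ℕ) * ρ ^ b) + ((b:ℝ) + 1) * ρ ^ (b + 1) := by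
    ext d; rw [PE_c2, PE_c3]; ring
  have e2 : ρ * (1 + 4 * ρ + ρ ^ 2) / (1 - ρ) ^ 4 =
      6 * ρ * (1 / (1 - ρ) ^ (3 + 1)) - 6 * ρ * (1 / (1 - ρ) ^ (2 + 1)) + ρ / (1 - ρ) ^ 2 := by
    field_simp; ring
  rw [e1, e2]; exact h

theorem PE_cosh (x : ℝ) : 1 + x ^ 2 / 2 + x ^ 4 / 24 + x ^ 6 / 720 ≤ Real.cosh x := by
  have h := Real.hasSum_cosh x
  have := sum_le_hasSum (Finset.range 4) (fun i _ => by rw [pow_mul]; positivity) h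
  simp only [Finset.sum_range_succ, Finset.sum_range_zero] at this
  norm_num [Nat.factorial] at this
  linarith

/-- `h(x) = (1-ρ)^2/ρ` with `ρ = exp (-x)` -/
theorem PE_h (x : ℝ) : x ^ 2 + x ^ 4 / 12 + x ^ 6 / 360 ≤ (1 - Real.exp (-x)) ^ 2 / Real.exp (-x) := by
  have h := PE_cosh x
  rw [Real.cosh_eq] at h
  have e : (1 - Real.exp (-x)) ^ 2 / Real.exp (-x) = Real.exp x + Real.exp (-x) - 2 := by
    rw [div_eq_iff (Real.exp_pos _).ne']
    have : Real.exp x * Real.exp (-x) = 1 := by rw [← Real.exp_add]; simp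
    linear_combination -this
  rw [e]; linarith

theorem PE_b0 (x : ℝ) (hx : 0 < x) : Real.exp (-x) / (1 - Real.exp (-x)) ≤ 1 / x := by
  have h1 : Real.exp (-x) < 1 := by rw [Real.exp_lt_one_iff]; linarith
  have h2 : x + 1 ≤ Real.exp x := Real.add_one_le_exp x
  have : Real.exp x * Real.exp (-x) = 1 := by rw [← Real.exp_add]; simp
  rw [div_le_div_iff₀ (by linarith) hx]
  have := mul_le_mul_of_nonneg_right h2 (Real.exp_pos (-x)).le
  nlinarith

theorem PE_b1 (x : ℝ) (hx : 0 < x) : Real.exp (-x) / (1 - Real.exp (-x)) ^ 2 ≤ 1 / x ^ 2 := by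
  have h1 : Real.exp (-x) < 1 := by rw [Real.exp_lt_one_iff]; linarith
  have h := PE_h x
  have h2 : x ^ 2 ≤ (1 - Real.exp (-x)) ^ 2 / Real.exp (-x) := le_trans (by nlinarith [pow_pos hx 4, pow_pos hx 6]) h
  rw [← one_div_div]
  exact one_div_le_one_div_of_le (by positivity) h2

theorem PE_b2 (x : ℝ) (hx : 0 < x) :
    Real.exp (-x) * (1 + Real.exp (-x)) / (1 - Real.exp (-x)) ^ 3 ≤ 2 / x ^ 3 := by
  have h1 : Real.exp (-x) < 1 := by rw [Real.exp_lt_one_iff]; linarith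
  have h := PE_h x
  have hρ := Real.exp_pos (-x)
  set ρ := Real.exp (-x)
  set H := (1 - ρ) ^ 2 / ρ with hH
  have hne : 1 - ρ ≠ 0 := by linarith
  have hpos : 0 < 1 - ρ := by linarith
  have e : (ρ * (1 + ρ) / (1 - ρ) ^ 3) ^ 2 = (H + 4) / H ^ 3 := by
    rw [hH]; field_simp; ring
  have hHpos : 0 < H := by positivity
  refine le_of_sq_le_sq ?_ (by positivity) 
  rw [e]
  clear e
  clear_value H
  rw [div_pow, div_le_div_iff₀ (by positivity) (by positivity)]
  have hh : x ^ 2 + x ^ 4 / 12 ≤ H := by linarith [pow_pos hx 6]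
  set H0 := x ^ 2 + x ^ 4 / 12 with hH0
  have hH0p : 0 < H0 := by positivity
  have k0 : (H0 + 4) * x ^ 6 ≤ 4 * H0 ^ 3 := by
    have : 4 * H0 ^ 3 - (H0 + 4) * x ^ 6 = 4 * x ^ 12 / 1728 := by rw [hH0]; ring
    have : 0 ≤ x ^ 12 := by positivity
    linarith
  have k1 : x ^ 6 ≤ 12 * H0 ^ 2 := by
    have : 12 * H0 ^ 2 = 12 * x ^ 4 + 2 * x ^ 6 + x ^ 8 / 12 := by rw [hH0]; ring
    have : 0 ≤ x ^ 4 := by positivity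
    have : 0 ≤ x ^ 8 := by positivity
    have : 0 ≤ x ^ 6 := by positivity
    linarith
  have k2 : 0 ≤ (H - H0) * (4 * (H ^ 2 + H * H0 + H0 ^ 2) - x ^ 6) := by
    apply mul_nonneg (by linarith)
    nlinarith
  nlinarith

theorem PE_b3 (x : ℝ) (hx : 0 < x) :
    Real.exp (-x) * (1 + 4 * Real.exp (-x) + Real.exp (-x) ^ 2) / (1 - Real.exp (-x)) ^ 4 ≤ 20 / 3 / x ^ 4 := by
  have h1 : Real.exp (-x) < 1 := by rw [Real.exp_lt_one_iff]; linarith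
  have h := PE_h x
  have hρ := Real.exp_pos (-x)
  set ρ := Real.exp (-x)
  set H := (1 - ρ) ^ 2 / ρ with hH
  have hne : 1 - ρ ≠ 0 := by linarith
  have hpos : 0 < 1 - ρ := by linarith
  have e : (ρ * (1 + 4 * ρ + ρ ^ 2) / (1 - ρ) ^ 4) = 1 / H + 6 / H ^ 2 := by
    rw [hH]; field_simp; ring
  have hHpos : 0 < H := by positivity
  set H0 := x ^ 2 + x ^ 4 / 12 + x ^ 6 / 360 with hH0
  have hH0p : 0 < H0 := by positivity
  rw [e]
  calc 1 / H + 6 / H ^ 2 ≤ 1 / H0 + 6 / H0 ^ 2 := by gcongr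
    _ = (H0 + 6) / H0 ^ 2 := by field_simp
    _ ≤ _ := by
      rw [div_le_div_iff₀ (by positivity) (by positivity)]
      have : 20 / 3 * H0 ^ 2 - (H0 + 6) * x ^ 4 = x ^ 4 * (2 / 3 + x ^ 2 / 9 + x ^ 4 * (1 / 216) * 0 + x ^ 4 * (20 / 3 * (1 / 144 + 1 / 180) - 1 / 12) + x ^ 6 * (20 / 3 * (1 / 2160) - 1 / 360) + 20 / 3 * x ^ 8 / 129600) := by
        rw [hH0]; ring
      have : 0 ≤ x ^ 4 * (2 / 3 + x ^ 2 / 9 + x ^ 4 * (1 / 216) * 0 + x ^ 4 * (20 / 3 * (1 / 144 + 1 / 180) - 1 / 12) + x ^ 6 * (20 / 3 * (1 / 2160) - 1 / 360) + 20 / 3 * x ^ 8 / 129600) := by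
        apply mul_nonneg (by positivity)
        norm_num; positivity
      linarith


theorem PE_K0 (t : ℝ) (ht : 0 < t) : Summable (fun x : ℕ × ℕ => Real.exp (-t) ^ ((x.1 + 1) * (x.2 + 1)) / ((x.1:ℝ) + 1)) ∧
    ∑' x : ℕ × ℕ, Real.exp (-t) ^ ((x.1 + 1) * (x.2 + 1)) / ((x.1:ℝ) + 1) ≤ (1 / t) * (Real.pi ^ 2 / 6) := by
  have hJ : ∀ j : ℕ, 0 < ((j:ℝ) + 1) * t := fun j => by positivity
  have hr : ∀ j : ℕ, Real.exp (-t) ^ (j + 1) = Real.exp (-(((j:ℝ) + 1) * t)) := fun j => by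
    rw [← Real.exp_nat_mul]; congr 1; push_cast; ring
  refine PE_prod _ (fun j => Real.exp (-(((j:ℝ) + 1) * t)) / (1 - Real.exp (-(((j:ℝ) + 1) * t))) / ((j:ℝ) + 1)) _ (fun x => by positivity) (fun j => ?_) (fun j => ?_)
  · simp only [pow_mul, hr]
    exact (PE_g0 _ (Real.exp_pos _) (by rw [Real.exp_lt_one_iff]; linarith [hJ j])).div_const _
  · have := PE_b0 _ (hJ j)
    calc _ ≤ 1 / (((j:ℝ) + 1) * t) / ((j:ℝ) + 1) := by gcongr
      _ = _ := by field_simp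

theorem PE_K1 (t : ℝ) (ht : 0 < t) : Summable (fun x : ℕ × ℕ => ((x.2:ℝ) + 1) * Real.exp (-t) ^ ((x.1 + 1) * (x.2 + 1))) ∧
    ∑' x : ℕ × ℕ, ((x.2:ℝ) + 1) * Real.exp (-t) ^ ((x.1 + 1) * (x.2 + 1)) ≤ (1 / t ^ 2) * (Real.pi ^ 2 / 6) := by
  have hJ : ∀ j : ℕ, 0 < ((j:ℝ) + 1) * t := fun j => by positivity
  have hr : ∀ j : ℕ, Real.exp (-t) ^ (j + 1) = Real.exp (-(((j:ℝ) + 1) * t)) := fun j => by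
    rw [← Real.exp_nat_mul]; congr 1; push_cast; ring
  refine PE_prod _ (fun j => Real.exp (-(((j:ℝ) + 1) * t)) / (1 - Real.exp (-(((j:ℝ) + 1) * t))) ^ 2) _ (fun x => by positivity) (fun j => ?_) (fun j => ?_)
  · simp only [pow_mul, hr]
    exact (PE_g1 _ (Real.exp_pos _) (by rw [Real.exp_lt_one_iff]; linarith [hJ j]))
  · have := PE_b1 _ (hJ j)
    calc _ ≤ 1 / (((j:ℝ) + 1) * t) ^ 2 := by gcongr
      _ = _ := by field_simp

theorem PE_K2 (t : ℝ) (ht : 0 < t) : Summable (fun x : ℕ × ℕ => ((x.1:ℝ) + 1) * (((x.2:ℝ) + 1) ^ 2 * Real.exp (-t) ^ ((x.1 + 1) * (x.2 + 1)))) ∧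
    ∑' x : ℕ × ℕ, ((x.1:ℝ) + 1) * (((x.2:ℝ) + 1) ^ 2 * Real.exp (-t) ^ ((x.1 + 1) * (x.2 + 1))) ≤ (2 / t ^ 3) * (Real.pi ^ 2 / 6) := by
  have hJ : ∀ j : ℕ, 0 < ((j:ℝ) + 1) * t := fun j => by positivity
  have hr : ∀ j : ℕ, Real.exp (-t) ^ (j + 1) = Real.exp (-(((j:ℝ) + 1) * t)) := fun j => by
    rw [← Real.exp_nat_mul]; congr 1; push_cast; ring
  refine PE_prod _ (fun j => ((j:ℝ) + 1) * (Real.exp (-(((j:ℝ) + 1) * t)) * (1 + Real.exp (-(((j:ℝ) + 1) * t))) / (1 - Real.exp (-(((j:ℝ) + 1) * t))) ^ 3)) _ (fun x => by positivity) (fun j => ?_) (fun j => ?_)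
  · simp only [pow_mul, hr]
    exact (PE_g2 _ (Real.exp_pos _) (by rw [Real.exp_lt_one_iff]; linarith [hJ j])).mul_left _
  · have := PE_b2 _ (hJ j)
    calc _ ≤ ((j:ℝ) + 1) * (2 / (((j:ℝ) + 1) * t) ^ 3) := by gcongr
      _ = _ := by field_simp

theorem PE_K3 (t : ℝ) (ht : 0 < t) : Summable (fun x : ℕ × ℕ => ((x.1:ℝ) + 1) ^ 2 * (((x.2:ℝ) + 1) ^ 3 * Real.exp (-t) ^ ((x.1 + 1) * (x.2 + 1)))) ∧
    ∑' x : ℕ × ℕ, ((x.1:ℝ) + 1) ^ 2 * (((x.2:ℝ) + 1) ^ 3 * Real.exp (-t) ^ ((x.1 + 1) * (x.2 + 1))) ≤ (20 / 3 / t ^ 4) * (Real.pi ^ 2 / 6) := by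
  have hJ : ∀ j : ℕ, 0 < ((j:ℝ) + 1) * t := fun j => by positivity
  have hr : ∀ j : ℕ, Real.exp (-t) ^ (j + 1) = Real.exp (-(((j:ℝ) + 1) * t)) := fun j => by
    rw [← Real.exp_nat_mul]; congr 1; push_cast; ring
  refine PE_prod _ (fun j => ((j:ℝ) + 1) ^ 2 * (Real.exp (-(((j:ℝ) + 1) * t)) * (1 + 4 * Real.exp (-(((j:ℝ) + 1) * t)) + Real.exp (-(((j:ℝ) + 1) * t)) ^ 2) / (1 - Real.exp (-(((j:ℝ) + 1) * t))) ^ 4)) _ (fun x => by positivity) (fun j => ?_) (fun j => ?_)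
  · simp only [pow_mul, hr]
    exact (PE_g3 _ (Real.exp_pos _) (by rw [Real.exp_lt_one_iff]; linarith [hJ j])).mul_left _
  · have := PE_b3 _ (hJ j)
    calc _ ≤ ((j:ℝ) + 1) ^ 2 * (20 / 3 / (((j:ℝ) + 1) * t) ^ 4) := by gcongr
      _ = _ := by field_simp

theorem PG_chord (y : ℝ) (h1 : 0.25 ≤ y) (h2 : y ≤ 1.21) : 0.164 ≤ y * Real.exp (-(1.645 * y)) := by
  have E2 : Real.exp 1.99045 ≤ 1.21 / 0.164 := by
    have a := Real.exp_one_lt_d9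
    have b := Real.add_one_le_exp (0.00955:ℝ)
    have e : Real.exp 1 * Real.exp 1 = Real.exp 1.99045 * Real.exp 0.00955 := by
      rw [← Real.exp_add, ← Real.exp_add]; norm_num
    have a2 : Real.exp 1 * Real.exp 1 ≤ 7.3891 := by nlinarith [Real.exp_pos 1]
    have p := Real.exp_pos 1.99045
    norm_num at *
    nlinarith
  have E1 : Real.exp 0.41125 ≤ 0.25 / 0.164 := by
    have := Real.exp_bound (x := 0.41125) (by norm_num [abs_le]) (n := 5) (by norm_num)
    rw [abs_le] at this
    have := this.2
    simp only [Finset.sum_range_succ, Finset.sum_range_zero] at this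
    norm_num [Nat.factorial, abs_of_pos] at this
    norm_num
    linarith
  have p1 : 0 ≤ (1.21 - y) / 0.96 := by apply div_nonneg <;> norm_num <;> linarith
  have p2 : 0 ≤ (y - 0.25) / 0.96 := by apply div_nonneg <;> norm_num <;> linarith
  have p3 : (1.21 - y) / 0.96 + (y - 0.25) / 0.96 = 1 := by ring
  have hcc := convexOn_exp.2
  have hc := hcc (Set.mem_univ (0.41125:ℝ)) (Set.mem_univ (1.99045:ℝ)) p1 p2 p3
  simp only [smul_eq_mul] at hc
  have e : (1.21 - y) / 0.96 * 0.41125 + (y - 0.25) / 0.96 * 1.99045 = 1.645 * y := by ring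
  rw [e] at hc
  have hk : Real.exp (1.645 * y) ≤ y / 0.164 := by
    refine hc.trans ?_
    have k1 : (1.21 - y) / 0.96 * Real.exp 0.41125 ≤ (1.21 - y) / 0.96 * (0.25 / 0.164) :=
      mul_le_mul_of_nonneg_left E1 (by apply div_nonneg <;> norm_num <;> linarith)
    have k2 : (y - 0.25) / 0.96 * Real.exp 1.99045 ≤ (y - 0.25) / 0.96 * (1.21 / 0.164) :=
      mul_le_mul_of_nonneg_left E2 (by apply div_nonneg <;> norm_num <;> linarith)
    have : (1.21 - y) / 0.96 * (0.25 / 0.164) + (y - 0.25) / 0.96 * (1.21 / 0.164) = y / 0.164 := by ring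
    linarith
  rw [Real.exp_neg, ← div_eq_mul_inv, le_div_iff₀ (Real.exp_pos _)]
  rw [le_div_iff₀ (by norm_num)] at hk
  linarith

theorem PG_exp098 (x : ℝ) (hx : 9.98 ≤ x) : 16 * x ^ 3 ≤ Real.exp (0.098 * x ^ 2) := by
  have hX : 99.6004 ≤ x ^ 2 := by nlinarith
  have hy : 0 ≤ 0.098 * x ^ 2 - 9.76 := by norm_num at *; linarith
  have a := Real.exp_one_gt_d9
  have q := Real.quadratic_le_exp_of_nonneg hy
  have q2 := Real.quadratic_le_exp_of_nonneg (x := 0.76) (by norm_num)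
  have e : Real.exp (0.098 * x ^ 2) = Real.exp 1 ^ 9 * Real.exp 0.76 * Real.exp (0.098 * x ^ 2 - 9.76) := by
    rw [← Real.exp_nat_mul, ← Real.exp_add, ← Real.exp_add]; congr 1; norm_num
  have e9 : 8090 ≤ Real.exp 1 ^ 9 := by
    calc (8090:ℝ) ≤ 2.718 ^ 9 := by norm_num
      _ ≤ _ := by gcongr; linarith
  have m : 16500 ≤ Real.exp 1 ^ 9 * Real.exp 0.76 := by
    calc (16500:ℝ) ≤ 8090 * 2.04 := by norm_num
      _ ≤ _ := by gcongr; refine le_trans ?_ q2; norm_num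
  rw [e]
  have h3 : x ^ 3 * 9.98 ≤ (x ^ 2) ^ 2 := by
    have : (x^2)^2 = x ^ 3 * x := by ring
    rw [this]; gcongr
  set X := x ^ 2
  calc 16 * x ^ 3 ≤ 16500 * (1 + (0.098 * X - 9.76) + (0.098 * X - 9.76) ^ 2 / 2) := by
        norm_num at *; nlinarith
    _ ≤ _ := by gcongr

theorem PG_gauss (x a b : ℝ) (hx : 0 < x) (hab : a ≤ b) (ha : 2 ≤ a * x ^ 3) :
    ∫ θ in a..b, θ ^ 2 * Real.exp (-(0.89 * (θ * x ^ 3) ^ 2)) ≤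
      0.654 * (a * Real.exp (-(0.89 * (a * x ^ 3) ^ 2)) / x ^ 6) := by
  have hd : ∀ θ : ℝ, HasDerivAt (fun θ => -0.654 / x ^ 6 * (θ * Real.exp (-(0.89 * (θ * x ^ 3) ^ 2))))
      (0.654 / x ^ 6 * Real.exp (-(0.89 * (θ * x ^ 3) ^ 2)) * (1.78 * (θ * x ^ 3) ^ 2 - 1)) θ := by
    intro θ
    have h1 : HasDerivAt (fun θ : ℝ => -(0.89 * (θ * x ^ 3) ^ 2)) (-(0.89 * (2 * (θ * x ^ 3) ^ 1 * (1 * x ^ 3)))) θ :=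
      ((((hasDerivAt_id θ).mul_const (x ^ 3)).pow 2).const_mul 0.89).neg
    have h2 := ((hasDerivAt_id θ).mul h1.exp).const_mul (-0.654 / x ^ 6)
    refine h2.congr_deriv ?_
    simp only [id]
    ring
  have hc : Continuous fun θ : ℝ => 0.654 / x ^ 6 * Real.exp (-(0.89 * (θ * x ^ 3) ^ 2)) * (1.78 * (θ * x ^ 3) ^ 2 - 1) := by
    fun_prop
  have hI := intervalIntegral.integral_eq_sub_of_hasDerivAt (fun θ _ => hd θ) (hc.intervalIntegrable a b)
  have hm := intervalIntegral.integral_mono_on (μ := MeasureTheory.volume) hab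
    (f := fun θ => θ ^ 2 * Real.exp (-(0.89 * (θ * x ^ 3) ^ 2)))
    (Continuous.intervalIntegrable (by fun_prop) a b) (hc.intervalIntegrable a b) (by
      intro θ hθ
      have hθ2 : 2 ≤ θ * x ^ 3 := ha.trans (by gcongr; exact hθ.1)
      have e : θ ^ 2 = (θ * x ^ 3) ^ 2 / x ^ 6 := by field_simp
      rw [show θ ^ 2 * Real.exp (-(0.89 * (θ * x ^ 3) ^ 2)) = (θ * x ^ 3) ^ 2 * (Real.exp (-(0.89 * (θ * x ^ 3) ^ 2)) / x ^ 6) by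
        rw [e]; ring_nf]
      rw [show 0.654 / x ^ 6 * Real.exp (-(0.89 * (θ * x ^ 3) ^ 2)) * (1.78 * (θ * x ^ 3) ^ 2 - 1) = (0.654 * (1.78 * (θ * x ^ 3) ^ 2 - 1)) * (Real.exp (-(0.89 * (θ * x ^ 3) ^ 2)) / x ^ 6) by ring]
      gcongr
      norm_num at *
      nlinarith)
  rw [hI] at hm
  refine hm.trans ?_
  have hb : 0 ≤ b := by
    have : 0 < a * x ^ 3 := by linarith
    have : 0 < a := by by_contra hh; push Not at hh; nlinarith [pow_pos hx 3]
    linarith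
  have : 0 ≤ 0.654 / x ^ 6 * (b * Real.exp (-(0.89 * (b * x ^ 3) ^ 2))) := by positivity
  have e1 : -0.654 / x ^ 6 * (b * Real.exp (-(0.89 * (b * x ^ 3) ^ 2))) = -(0.654 / x ^ 6 * (b * Real.exp (-(0.89 * (b * x ^ 3) ^ 2)))) := by ring
  have e2 : 0.654 * (a * Real.exp (-(0.89 * (a * x ^ 3) ^ 2)) / x ^ 6) = - (-0.654 / x ^ 6 * (a * Real.exp (-(0.89 * (a * x ^ 3) ^ 2)))) := by ring
  linarith

theorem PG_exp356 : Real.exp (-(0.89 * 2 ^ 2)) ≤ 1 / 34 := by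
  have a := Real.exp_one_gt_d9
  have q2 := Real.quadratic_le_exp_of_nonneg (x := 0.56) (by norm_num)
  have e : Real.exp (0.89 * 2 ^ 2) = Real.exp 1 ^ 3 * Real.exp 0.56 := by
    rw [← Real.exp_nat_mul, ← Real.exp_add]; congr 1; norm_num
  have m : 34 ≤ Real.exp 1 ^ 3 * Real.exp 0.56 := by
    calc (34:ℝ) ≤ 2.718 ^ 3 * 1.7 := by norm_num
      _ ≤ _ := by gcongr; · linarith
                  · refine le_trans ?_ q2; norm_num
  rw [Real.exp_neg, e, inv_eq_one_div]
  exact one_div_le_one_div_of_le (by norm_num) m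

theorem PG_cos_upper (θ : ℝ) (h0 : 0 ≤ θ) (h : θ ≤ 0.011) : 0.4999 * θ ^ 2 ≤ 1 - Real.cos θ := by
  have := Real.cos_bound (x := θ) (by rw [abs_of_nonneg h0]; norm_num at *; linarith)
  rw [abs_le, abs_of_nonneg h0] at this
  have := this.2
  have h4 : θ ^ 4 ≤ 0.011 ^ 2 * θ ^ 2 := by
    rw [show θ ^ 4 = θ ^ 2 * θ ^ 2 by ring]; gcongr
  norm_num at *
  linarith [sq_nonneg θ]

theorem PG_cosh (t : ℝ) (h0 : 0 < t) (h : t ≤ 0.011) : Real.cosh t - 1 ≤ 0.50005 * t ^ 2 := by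
  have h1 := Real.cosh_le_exp_half_sq t
  have ht2 : t ^ 2 ≤ 0.011 ^ 2 := by gcongr
  have h2 := Real.abs_exp_sub_one_sub_id_le (x := t ^ 2 / 2) (by rw [abs_of_nonneg (by positivity)]; norm_num at *; linarith)
  rw [abs_le] at h2
  have h3 := h2.2
  have : (t ^ 2 / 2) ^ 2 ≤ 0.011 ^ 2 * t ^ 2 / 4 := by nlinarith [sq_nonneg t]
  norm_num at *
  linarith [sq_nonneg t]

theorem PG_ratio (g c c0 N : ℝ) (hN : 0 < N) (hg : 0 < g) (hc0 : 0 ≤ c0) (h : c0 ≤ c) :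
    N * (c0 / (g + c0)) ≤ N * (c / (g + c)) := by
  gcongr N * ?_
  rw [div_le_div_iff₀ (by linarith) (by linarith)]
  nlinarith

theorem PG_V (x θ g V : ℝ) (hx : 9.98 ≤ x) (hg0 : 0 < g) (hg : g ≤ 0.50005 * (1 / x ^ 2) ^ 2) (h0 : 0 ≤ θ) (hπ : θ ≤ Real.pi)
    (hV : x ^ 2 * ((1 - Real.cos θ) / (g + (1 - Real.cos θ))) ≤ V) :
    (θ ≤ 1 / x ^ 2 / 3 → 0.89 * (θ * x ^ 3) ^ 2 ≤ V) ∧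
    (1 / x ^ 2 / 3 ≤ θ → 0.098 * x ^ 2 ≤ V) ∧ (1 / x ^ 2 ≤ θ → 0.49 * x ^ 2 ≤ V) := by
  have hx0 : 0 < x := by norm_num at hx; linarith
  have ht : 1 / x ^ 2 ≤ 0.011 := by
    rw [div_le_iff₀ (by positivity)]; norm_num at *; nlinarith
  set t := 1 / x ^ 2 with htd
  have htp : 0 < t := by positivity
  have hxt : x ^ 2 * t = 1 := by rw [htd]; field_simp
  have key : ∀ τ, 0 ≤ τ → τ ≤ θ → τ ≤ t → x ^ 2 * (0.4999 * τ ^ 2 / (0.50005 * t ^ 2 + 0.4999 * τ ^ 2)) ≤ V := by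
    intro τ h1 h2 h3
    refine le_trans ?_ hV
    have c1 := PG_cos_upper τ h1 (h3.trans ht)
    have c2 : Real.cos θ ≤ Real.cos τ := Real.cos_le_cos_of_nonneg_of_le_pi h1 hπ h2
    refine le_trans ?_ (PG_ratio g (1 - Real.cos θ) (0.4999 * τ ^ 2) (x ^ 2) (by positivity) hg0 (by positivity) (by linarith))
    gcongr
  refine ⟨fun h => ?_, fun h => ?_, fun h => ?_⟩
  · refine le_trans ?_ (key θ h0 le_rfl (by linarith))
    have e : 0.89 * (θ * x ^ 3) ^ 2 = x ^ 2 * (0.89 * θ ^ 2 / t ^ 2) := by rw [htd]; field_simp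
    rw [e]
    gcongr x ^ 2 * ?_
    rw [div_le_div_iff₀ (by positivity) (by positivity)]
    have : θ ^ 2 ≤ (t / 3) ^ 2 := by gcongr
    have h5 : 0.89 * (0.50005 * t ^ 2 + 0.4999 * θ ^ 2) ≤ 0.4999 * t ^ 2 := by norm_num at *; linarith [sq_nonneg t]
    have := mul_le_mul_of_nonneg_left h5 (sq_nonneg θ)
    linarith
  · refine le_trans ?_ (key (t / 3) (by positivity) h (by linarith))
    rw [mul_comm]
    gcongr x ^ 2 * ?_
    rw [le_div_iff₀ (by positivity)]
    norm_num; nlinarith [sq_nonneg t]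
  · refine le_trans ?_ (key t (by positivity) h le_rfl)
    rw [mul_comm]
    gcongr x ^ 2 * ?_
    rw [le_div_iff₀ (by positivity)]
    norm_num; nlinarith [sq_nonneg t]

set_option maxHeartbeats 4000000 in
theorem PH_int (x : ℝ) (V ψ f : ℝ → ℝ) (hx : 9.98 ≤ x)
    (hf : Continuous f) (hfe : ∀ θ, f θ = Real.exp (-V θ) * Real.cos (ψ θ) * (1 - Real.cos θ))
    (hV1 : ∀ θ, 0 ≤ θ → V θ ≤ 1.645 * (θ * x ^ 3) ^ 2)
    (hψ : ∀ θ, 0 ≤ θ → |ψ θ| ≤ 1.828 * (θ * x ^ 3) ^ 3 / x)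
    (hV2 : ∀ θ, 0 ≤ θ → x ^ 2 * ((1 - Real.cos θ) / (Real.cosh (1 / x ^ 2) - 1 + (1 - Real.cos θ))) ≤ V θ) :
    0 ≤ ∫ θ in (0:ℝ)..Real.pi, f θ := by
  have hx0 : 0 < x := by norm_num at hx; linarith
  have hx3 : 0 < x ^ 3 := by positivity
  have ht : 1 / x ^ 2 ≤ 0.011 := by
    rw [div_le_iff₀ (by positivity)]; norm_num at *; nlinarith
  have htp : 0 < 1 / x ^ 2 := by positivity
  have hg := PG_cosh _ htp ht
  have hg0 : 0 < Real.cosh (1 / x ^ 2) - 1 := by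
    have := Real.one_lt_cosh.2 htp.ne'
    linarith
  have hVV := fun θ (h0 : 0 ≤ θ) (hp : θ ≤ Real.pi) => PG_V x θ _ (V θ) hx hg0 hg h0 hp (hV2 θ h0)
  have hpi := Real.pi_gt_three
  have hpi4 := Real.pi_lt_d2
  set t := 1 / x ^ 2 with htd
  set s := 1 / x ^ 3 with hsd
  have hsp : 0 < s := by positivity
  have hsx : s * x ^ 3 = 1 := by rw [hsd]; field_simp
  have hts : t = x * s := by rw [htd, hsd]; field_simp
  have hst : 6 * s ≤ t := by rw [hts]; gcongr; norm_num at hx; linarith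
  have htpi : t ≤ Real.pi := by norm_num at ht; linarith
  have c0 : ∀ θ, 0 ≤ 1 - Real.cos θ := fun θ => by linarith [Real.cos_le_one θ]
  have c2 : ∀ θ, 1 - Real.cos θ ≤ θ ^ 2 / 2 := fun θ => by linarith [Real.one_sub_sq_div_two_le_cos (x := θ)]
  have habs : ∀ θ b, b ≤ V θ → ∀ c, 1 - Real.cos θ ≤ c → -(c * Real.exp (-b)) ≤ f θ := by
    intro θ b hb c hc
    rw [hfe]
    have h1 : Real.exp (-V θ) ≤ Real.exp (-b) := Real.exp_le_exp.2 (by linarith)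
    have h2 : |Real.exp (-V θ) * Real.cos (ψ θ) * (1 - Real.cos θ)| ≤ Real.exp (-b) * 1 * c := by
      rw [abs_mul, abs_mul, abs_of_pos (Real.exp_pos _), abs_of_nonneg (c0 θ)]
      gcongr
      · exact c0 θ
      · exact Real.abs_cos_le_one _
    have := (abs_le.1 h2).1
    linarith
  have hi : ∀ a b, IntervalIntegrable f MeasureTheory.volume a b := fun a b => hf.intervalIntegrable a b
  -- nonnegativity up to 2 s
  have hnn : ∀ θ, 0 ≤ θ → θ ≤ 2 * s → 0 ≤ f θ := by
    intro θ h1 h2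
    rw [hfe]
    have hv : θ * x ^ 3 ≤ 2 := by nlinarith
    have : |ψ θ| ≤ 1.47 := by
      refine (hψ θ h1).trans ?_
      calc 1.828 * (θ * x ^ 3) ^ 3 / x ≤ 1.828 * 2 ^ 3 / 9.98 := by gcongr
        _ ≤ 1.47 := by norm_num
    have hc : 0 ≤ Real.cos (ψ θ) := by
      rw [abs_le] at this
      apply Real.cos_nonneg_of_mem_Icc
      norm_num at this
      constructor <;> linarith
    exact mul_nonneg (mul_nonneg (Real.exp_pos _).le hc) (c0 θ)
  have I1 : 0 ≤ ∫ θ in (0:ℝ)..(0.5 * s), f θ :=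
    intervalIntegral.integral_nonneg (by positivity) fun θ h => hnn θ h.1 (h.2.trans (by gcongr; norm_num))
  have I3 : 0 ≤ ∫ θ in (1.1 * s)..(2 * s), f θ :=
    intervalIntegral.integral_nonneg (by gcongr; norm_num) fun θ h => hnn θ (le_trans (by positivity) h.1) h.2
  have I2 : 0.047 * s ^ 3 ≤ ∫ θ in (0.5 * s)..(1.1 * s), f θ := by
    have hm := intervalIntegral.integral_mono_on (μ := MeasureTheory.volume) (a := 0.5 * s) (b := 1.1 * s)
      (f := fun _ => (0.164 * 0.96 * 0.4999) * s ^ 2) (g := f) (by gcongr; norm_num)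
      (by simp) (hi _ _) (by
        intro θ hθ
        have h0 : 0 ≤ θ := le_trans (by positivity) hθ.1
        have v1 : 0.5 ≤ θ * x ^ 3 := by
          have := mul_le_mul_of_nonneg_right hθ.1 hx3.le
          rw [mul_assoc, hsx] at this; linarith
        have v2 : θ * x ^ 3 ≤ 1.1 := by
          have := mul_le_mul_of_nonneg_right hθ.2 hx3.le
          rw [mul_assoc, hsx] at this; linarith
        have k1 := PG_chord ((θ * x ^ 3) ^ 2) (by norm_num at *; nlinarith) (by norm_num at *; nlinarith)
        have k2 : Real.exp (-(1.645 * (θ * x ^ 3) ^ 2)) ≤ Real.exp (-V θ) := Real.exp_le_exp.2 (by linarith [hV1 θ h0])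
        have hp : |ψ θ| ≤ 0.25 := by
          refine (hψ θ h0).trans ?_
          calc 1.828 * (θ * x ^ 3) ^ 3 / x ≤ 1.828 * 1.1 ^ 3 / 9.98 := by gcongr
            _ ≤ 0.25 := by norm_num
        have k3 : 0.96 ≤ Real.cos (ψ θ) := by
          have := Real.one_sub_sq_div_two_le_cos (x := ψ θ)
          have : ψ θ ^ 2 ≤ 0.25 ^ 2 := by rw [← sq_abs]; gcongr
          norm_num at *; linarith
        have k4 := PG_cos_upper θ h0 (by
          refine le_trans hθ.2 ?_
          norm_num at *; linarith)
        show 0.164 * 0.96 * 0.4999 * s ^ 2 ≤ f θ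
        rw [hfe]
        have es : θ ^ 2 = (θ * x ^ 3) ^ 2 * s ^ 2 := by
          rw [show (θ * x ^ 3) ^ 2 * s ^ 2 = θ ^ 2 * (s * x ^ 3) ^ 2 by ring, hsx]; ring
        calc 0.164 * 0.96 * 0.4999 * s ^ 2 ≤ ((θ * x ^ 3) ^ 2 * Real.exp (-(1.645 * (θ * x ^ 3) ^ 2))) * 0.96 * 0.4999 * s ^ 2 := by gcongr
          _ = Real.exp (-(1.645 * (θ * x ^ 3) ^ 2)) * 0.96 * (0.4999 * θ ^ 2) := by rw [es]; ring
          _ ≤ _ := by gcongr)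
    rw [intervalIntegral.integral_const, smul_eq_mul] at hm
    refine le_trans ?_ hm
    have : (1.1 * s - 0.5 * s) * (0.164 * 0.96 * 0.4999 * s ^ 2) = (0.6 * (0.164 * 0.96 * 0.4999)) * s ^ 3 := by ring
    rw [this]; gcongr; norm_num
  have I4 : -(0.0195 * s ^ 3) ≤ ∫ θ in (2 * s)..(t / 3), f θ := by
    have hab : 2 * s ≤ t / 3 := by linarith
    have hm := intervalIntegral.integral_mono_on (μ := MeasureTheory.volume) (a := 2 * s) (b := t / 3)
      (f := fun θ => -(1 / 2 * (θ ^ 2 * Real.exp (-(0.89 * (θ * x ^ 3) ^ 2))))) (g := f) hab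
      (Continuous.intervalIntegrable (by fun_prop) _ _) (hi _ _) (by
        intro θ hθ
        have h0 : 0 ≤ θ := le_trans (by positivity) hθ.1
        have := habs θ _ ((hVV θ h0 (by linarith [hθ.2])).1 hθ.2) _ (c2 θ)
        refine le_trans (le_of_eq ?_) this
        ring)
    rw [intervalIntegral.integral_neg, intervalIntegral.integral_const_mul] at hm
    have e2 : 2 * s * x ^ 3 = 2 := by rw [mul_assoc, hsx]; ring
    have hgs := PG_gauss x (2 * s) (t / 3) hx0 hab e2.ge
    rw [e2] at hgs
    have e3 := PG_exp356
    have e6 : 1 / x ^ 6 = s ^ 2 := by rw [hsd]; field_simp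
    have : 0.654 * (2 * s * Real.exp (-(0.89 * 2 ^ 2)) / x ^ 6) ≤ 0.039 * s ^ 3 := by
      calc 0.654 * (2 * s * Real.exp (-(0.89 * 2 ^ 2)) / x ^ 6) = 0.654 * 2 * Real.exp (-(0.89 * 2 ^ 2)) * s * (1 / x ^ 6) := by ring
        _ = (0.654 * 2 * Real.exp (-(0.89 * 2 ^ 2))) * s ^ 3 := by rw [e6]; ring
        _ ≤ (0.654 * 2 * (1 / 34)) * s ^ 3 := by gcongr
        _ ≤ _ := by gcongr; norm_num
    norm_num at *
    linarith
  have hE := PG_exp098 x hx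
  have I5 : -(0.0105 * s ^ 3) ≤ ∫ θ in (t / 3)..t, f θ := by
    have hm := intervalIntegral.integral_mono_on (μ := MeasureTheory.volume) (a := t / 3) (b := t)
      (f := fun θ => -(θ ^ 2 * (1 / 2 * Real.exp (-(0.098 * x ^ 2))))) (g := f) (by linarith)
      (Continuous.intervalIntegrable (by fun_prop) _ _) (hi _ _) (by
        intro θ hθ
        have h0 : 0 ≤ θ := le_trans (by positivity) hθ.1
        have := habs θ _ ((hVV θ h0 (by linarith [hθ.2])).2.1 hθ.1) _ (c2 θ)
        refine le_trans (le_of_eq ?_) this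
        ring)
    rw [intervalIntegral.integral_neg, intervalIntegral.integral_mul_const, integral_pow] at hm
    refine le_trans ?_ hm
    rw [neg_le_neg_iff]
    have hq : Real.exp (-(0.098 * x ^ 2)) ≤ 1 / (16 * x ^ 3) := by
      rw [Real.exp_neg, inv_eq_one_div]
      exact one_div_le_one_div_of_le (by positivity) hE
    calc _ ≤ (t ^ 3 / 3) * (1 / 2 * (1 / (16 * x ^ 3))) := by
          have h3 : (t ^ (2 + 1) - (t / 3) ^ (2 + 1)) / (((2 : ℕ) : ℝ) + 1) ≤ t ^ 3 / 3 := by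
            push_cast
            have : 0 < t ^ 3 := by positivity
            have e : (t ^ (2 + 1) - (t / 3) ^ (2 + 1)) / ((2 : ℝ) + 1) = t ^ 3 / 3 - t ^ 3 / 81 := by ring
            rw [e]; linarith
          have h4 : 0 ≤ t ^ 3 / 3 := by positivity
          exact mul_le_mul h3 (by linarith) (by positivity) h4
      _ = 1 / 96 * s ^ 3 := by rw [htd, hsd]; field_simp; norm_num
      _ ≤ _ := by gcongr; norm_num
  have I6 : -(0.007 * s ^ 3) ≤ ∫ θ in t..Real.pi, f θ := by
    have hm := intervalIntegral.integral_mono_on (μ := MeasureTheory.volume) (a := t) (b := Real.pi)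
      (f := fun θ => -(2 * Real.exp (-(0.49 * x ^ 2)))) (g := f) htpi
      (by simp) (hi _ _) (by
        intro θ hθ
        have h0 : 0 ≤ θ := le_trans (by positivity) hθ.1
        exact habs θ _ ((hVV θ h0 hθ.2).2.2 hθ.1) 2 (by linarith [Real.neg_one_le_cos θ]))
    rw [intervalIntegral.integral_const, smul_eq_mul] at hm
    refine le_trans ?_ hm
    have e5 : Real.exp (0.49 * x ^ 2) = Real.exp (0.098 * x ^ 2) ^ 5 := by
      rw [← Real.exp_nat_mul]; congr 1; push_cast; ring
    have hE5 : 1000000 * x ^ 9 ≤ Real.exp (0.49 * x ^ 2) := by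
      rw [e5]
      calc 1000000 * x ^ 9 ≤ (16 * x ^ 3) ^ 5 := by
            have : (16 * x ^ 3) ^ 5 = 1048576 * (x ^ 9 * x ^ 6) := by ring
            rw [this]
            have : (1:ℝ) ≤ x ^ 6 := one_le_pow₀ (by norm_num at hx; linarith)
            have : x ^ 9 ≤ x ^ 9 * x ^ 6 := le_mul_of_one_le_right (by positivity) this
            have : 0 < x ^ 9 := by positivity
            linarith
        _ ≤ _ := by gcongr
    have hq : Real.exp (-(0.49 * x ^ 2)) ≤ 1 / (1000000 * x ^ 9) := by
      rw [Real.exp_neg, inv_eq_one_div]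
      exact one_div_le_one_div_of_le (by positivity) hE5
    have e9 : 1 / (1000000 * x ^ 9) = 0.000001 * s ^ 3 := by rw [hsd]; field_simp; norm_num
    rw [e9] at hq
    have : 0 ≤ Real.exp (-(0.49 * x ^ 2)) := (Real.exp_pos _).le
    have hs3 : 0 < s ^ 3 := by positivity
    have : (Real.pi - t) * Real.exp (-(0.49 * x ^ 2)) ≤ 4 * (0.000001 * s ^ 3) := by
      gcongr; norm_num at *; linarith
    norm_num at *
    linarith
  have hs3 : 0 < s ^ 3 := by positivity
  have A1 := intervalIntegral.integral_add_adjacent_intervals (hi 0 (0.5 * s)) (hi (0.5 * s) (1.1 * s))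
  have A2 := intervalIntegral.integral_add_adjacent_intervals (hi 0 (1.1 * s)) (hi (1.1 * s) (2 * s))
  have A3 := intervalIntegral.integral_add_adjacent_intervals (hi 0 (2 * s)) (hi (2 * s) (t / 3))
  have A4 := intervalIntegral.integral_add_adjacent_intervals (hi 0 (t / 3)) (hi (t / 3) t)
  have A5 := intervalIntegral.integral_add_adjacent_intervals (hi 0 t) (hi t Real.pi)
  rw [← A5, ← A4, ← A3, ← A2, ← A1]
  norm_num at *
  linarith

noncomputable def Pa (t : ℝ) (x : ℕ × ℕ) : ℝ := Real.exp (-t) ^ ((x.1 + 1) * (x.2 + 1)) / ((x.1:ℝ) + 1)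
noncomputable def Pm (x : ℕ × ℕ) : ℝ := ((x.1:ℝ) + 1) * ((x.2:ℝ) + 1)
noncomputable def PV (t θ : ℝ) : ℝ := ∑' x, Pa t x * (1 - Real.cos (Pm x * θ))
noncomputable def PPh (t θ : ℝ) : ℝ := ∑' x, Pa t x * Real.sin (Pm x * θ)

theorem Pa_pos (t : ℝ) (x) : 0 < Pa t x := by unfold Pa; positivity
theorem Pm_pos (x) : 0 < Pm x := by unfold Pm; positivity
theorem Pa_summable (t : ℝ) (ht : 0 < t) : Summable (Pa t) := (PE_K0 t ht).1

theorem Pa_summable_mul (t : ℝ) (ht : 0 < t) (g : ℕ × ℕ → ℝ) (C : ℝ) (hg : ∀ x, |g x| ≤ C) : Summable fun x => Pa t x * g x := by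
  refine Summable.of_norm_bounded ((Pa_summable t ht).mul_right C) fun x => ?_
  rw [Real.norm_eq_abs, abs_mul, abs_of_pos (Pa_pos t x)]
  exact mul_le_mul_of_nonneg_left (hg x) (Pa_pos t x).le

theorem PI_term (t θ : ℝ) (x : ℕ × ℕ) :
    ((Real.exp (-t) : ℂ) * Complex.exp (θ * Complex.I)) ^ ((x.1 + 1) * (x.2 + 1)) / ((x.1:ℂ) + 1) =
      ((Pa t x * Real.cos (Pm x * θ) : ℝ) : ℂ) + ((Pa t x * Real.sin (Pm x * θ) : ℝ) : ℂ) * Complex.I := by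
  rw [mul_pow, ← Complex.exp_nat_mul]
  have e : (((x.1 + 1) * (x.2 + 1) : ℕ) : ℂ) * (θ * Complex.I) = ((Pm x * θ : ℝ) : ℂ) * Complex.I := by
    unfold Pm; push_cast; ring
  rw [e, Complex.exp_mul_I]
  unfold Pa
  push_cast
  ring

theorem PI_PL (t θ : ℝ) (ht : 0 < t) :
    PL ((Real.exp (-t) : ℂ) * Complex.exp (θ * Complex.I)) = (((∑' x, Pa t x) - PV t θ : ℝ) : ℂ) + (PPh t θ : ℂ) * Complex.I := by
  have s1 := Pa_summable_mul t ht (fun x => Real.cos (Pm x * θ)) 1 fun x => Real.abs_cos_le_one _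
  have s2 := Pa_summable_mul t ht (fun x => Real.sin (Pm x * θ)) 1 fun x => Real.abs_sin_le_one _
  have e : (∑' x, Pa t x) - PV t θ = ∑' x, Pa t x * Real.cos (Pm x * θ) := by
    have h : PV t θ = (∑' x, Pa t x) - ∑' x, Pa t x * Real.cos (Pm x * θ) := by
      unfold PV
      rw [← (Pa_summable t ht).tsum_sub s1]
      congr 1; ext x; ring
    rw [h]; ring
  rw [e]
  unfold PL PPh
  simp only [PI_term]
  have h1 : HasSum (fun x => ((Pa t x * Real.cos (Pm x * θ) : ℝ) : ℂ)) ((∑' x, Pa t x * Real.cos (Pm x * θ) : ℝ) : ℂ) :=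
    Complex.hasSum_ofReal.2 s1.hasSum
  have h2 : HasSum (fun x => ((Pa t x * Real.sin (Pm x * θ) : ℝ) : ℂ)) ((∑' x, Pa t x * Real.sin (Pm x * θ) : ℝ) : ℂ) :=
    Complex.hasSum_ofReal.2 s2.hasSum
  exact (h1.add (h2.mul_right Complex.I)).tsum_eq

theorem PI_norm (t θ : ℝ) (ht : 0 < t) : ‖(Real.exp (-t) : ℂ) * Complex.exp (θ * Complex.I)‖ < 1 := by
  rw [norm_mul, Complex.norm_exp_ofReal_mul_I, mul_one, Complex.norm_real, Real.norm_of_nonneg (Real.exp_pos _).le, Real.exp_lt_one_iff]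
  linarith

theorem PI_hasSum (t θ : ℝ) (ht : 0 < t) (n : ℕ) :
    HasSum (fun m : ℕ => (p m : ℝ) * Real.exp (-t) ^ m * Real.cos (((m:ℝ) - n) * θ))
      (Real.exp (∑' x, Pa t x) * (Real.exp (-PV t θ) * Real.cos (PPh t θ - n * θ))) := by
  have h := (PD_hasSum _ (PI_norm t θ ht)).mul_right (Complex.exp (((-(n * θ) : ℝ) : ℂ) * Complex.I))
  rw [PI_PL t θ ht, ← Complex.exp_add] at h
  have h2 := Complex.hasSum_re h
  have ev : (Complex.exp ((((∑' x, Pa t x) - PV t θ : ℝ) : ℂ) + (PPh t θ : ℂ) * Complex.I + ((-(n * θ) : ℝ) : ℂ) * Complex.I)).re =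
      Real.exp (∑' x, Pa t x) * (Real.exp (-PV t θ) * Real.cos (PPh t θ - n * θ)) := by
    rw [Complex.exp_re, ← mul_assoc, ← Real.exp_add]
    congr 2 <;> simp [sub_eq_add_neg]
  rw [ev] at h2
  have ef : (fun m : ℕ => (p m : ℝ) * Real.exp (-t) ^ m * Real.cos (((m:ℝ) - n) * θ)) = fun m : ℕ => ((p m : ℂ) * ((Real.exp (-t) : ℂ) * Complex.exp (θ * Complex.I)) ^ m * Complex.exp (((-(n * θ) : ℝ) : ℂ) * Complex.I)).re := by
    ext m
    rw [mul_pow, ← Complex.exp_nat_mul]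
    have e : (p m : ℂ) * ((Real.exp (-t) : ℂ) ^ m * Complex.exp ((m:ℂ) * (θ * Complex.I))) * Complex.exp (((-(n * θ) : ℝ) : ℂ) * Complex.I) =
        (((p m : ℝ) * Real.exp (-t) ^ m : ℝ) : ℂ) * Complex.exp ((((m - n) * θ : ℝ) : ℂ) * Complex.I) := by
      have : ((((m - n) * θ : ℝ) : ℂ) * Complex.I) = (m:ℂ) * (θ * Complex.I) + (((-(n * θ) : ℝ) : ℂ) * Complex.I) := by
        push_cast; ring
      rw [this, Complex.exp_add]; push_cast; ring
    rw [e, Complex.re_ofReal_mul, Complex.exp_ofReal_mul_I_re]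
  rw [ef]; exact h2

theorem PI_bound (n : ℕ) (t : ℝ) (ht : 0 < t) : (p n : ℝ) ≤ Real.exp ((1 / t) * (Real.pi ^ 2 / 6) + n * t) := by
  have h := PI_hasSum t 0 ht n
  have hV : PV t 0 = 0 := by simp [PV]
  have hP : PPh t 0 = 0 := by simp [PPh]
  rw [hV, hP] at h
  simp only [mul_zero, Real.cos_zero, mul_one, sub_zero, neg_zero, Real.exp_zero] at h
  have h1 := le_hasSum h n fun m _ => by positivity
  have h2 : (p n : ℝ) * Real.exp (-t) ^ n ≤ Real.exp ((1 / t) * (Real.pi ^ 2 / 6)) :=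
    h1.trans (Real.exp_le_exp.2 (PE_K0 t ht).2)
  rw [← Real.exp_nat_mul] at h2
  rw [Real.exp_add]
  calc (p n : ℝ) = (p n : ℝ) * Real.exp (n * -t) * Real.exp (n * t) := by
        rw [mul_assoc, ← Real.exp_add]; simp
    _ ≤ _ := by gcongr

theorem PI_512 (n : ℕ) (hn : n < 2 ^ 14) : p n < 2 ^ 512 := by
  have h := PI_bound n (1 / 100) (by norm_num)
  have hpi : Real.pi ^ 2 / 6 ≤ 1.66 := by nlinarith [Real.pi_lt_d2, Real.pi_pos]
  have hn' : (n:ℝ) ≤ 16384 := by exact_mod_cast hn.le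
  have h2 : (p n : ℝ) ≤ Real.exp 1 ^ 330 := by
    rw [← Real.exp_nat_mul]
    refine h.trans (Real.exp_le_exp.2 ?_)
    norm_num at hpi ⊢; linarith
  have : (p n : ℝ) < 2 ^ 512 := by
    refine h2.trans_lt ?_
    calc Real.exp 1 ^ 330 ≤ 2.7183 ^ 330 := by gcongr; have := Real.exp_one_lt_d9; norm_num at *; linarith
      _ = (2.7183 ^ 33) ^ 10 := by rw [← pow_mul]
      _ ≤ (2 ^ 51) ^ 10 := by gcongr; norm_num
      _ = 2 ^ 510 := by rw [← pow_mul]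
      _ < 2 ^ 512 := pow_lt_pow_right₀ (by norm_num) (by norm_num)
  exact_mod_cast this

noncomputable def Pf (t : ℝ) (n : ℕ) (θ : ℝ) : ℝ := Real.exp (-PV t θ) * Real.cos (PPh t θ - n * θ) * (1 - Real.cos θ)

theorem PJ_hasSum (t θ : ℝ) (ht : 0 < t) (n : ℕ) :
    HasSum (fun m : ℕ => (p m : ℝ) * Real.exp (-t) ^ m * (Real.cos (((m:ℝ) - n) * θ) * (1 - Real.cos θ)))
      (Real.exp (∑' x, Pa t x) * Pf t n θ) := by
  have h := (PI_hasSum t θ ht n).mul_right (1 - Real.cos θ)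
  have e : Real.exp (∑' x, Pa t x) * Pf t n θ = Real.exp (∑' x, Pa t x) * (Real.exp (-PV t θ) * Real.cos (PPh t θ - n * θ)) * (1 - Real.cos θ) := by
    unfold Pf; ring
  rw [e]
  simpa only [mul_assoc] using h

theorem PJ_w (t : ℝ) (ht : 0 < t) : Summable fun m : ℕ => (p m : ℝ) * Real.exp (-t) ^ m :=
  PD_summable_real _ (Real.exp_pos _).le (by rw [Real.exp_lt_one_iff]; linarith)

theorem PJ_bd (t θ : ℝ) (n m : ℕ) : ‖(p m : ℝ) * Real.exp (-t) ^ m * (Real.cos (((m:ℝ) - n) * θ) * (1 - Real.cos θ))‖ ≤ (p m : ℝ) * Real.exp (-t) ^ m * 2 := by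
  rw [norm_mul, Real.norm_of_nonneg (by positivity)]
  gcongr
  rw [Real.norm_eq_abs, abs_mul]
  have h1 := Real.abs_cos_le_one (((m:ℝ) - n) * θ)
  have h2 : |1 - Real.cos θ| ≤ 2 := by rw [abs_le]; constructor <;> linarith [Real.cos_le_one θ, Real.neg_one_le_cos θ]
  calc _ ≤ (1:ℝ) * 2 := by gcongr
    _ = 2 := by ring

theorem PJ_cont (t : ℝ) (ht : 0 < t) (n : ℕ) : Continuous (Pf t n) := by
  have h : Continuous fun θ => ∑' m : ℕ, (p m : ℝ) * Real.exp (-t) ^ m * (Real.cos (((m:ℝ) - n) * θ) * (1 - Real.cos θ)) :=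
    continuous_tsum (fun m => by fun_prop) ((PJ_w t ht).mul_right 2) fun m θ => PJ_bd t θ n m
  have e : Pf t n = fun θ => (Real.exp (∑' x, Pa t x))⁻¹ * ∑' m : ℕ, (p m : ℝ) * Real.exp (-t) ^ m * (Real.cos (((m:ℝ) - n) * θ) * (1 - Real.cos θ)) := by
    ext θ
    rw [(PJ_hasSum t θ ht n).tsum_eq, inv_mul_cancel_left₀ (Real.exp_pos _).ne']
  rw [e]
  exact h.const_mul _

theorem PJ_cos (k : ℤ) : ∫ θ in (0:ℝ)..Real.pi, Real.cos ((k:ℝ) * θ) = if k = 0 then Real.pi else 0 := by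
  split_ifs with h
  · subst h; simp
  · have hk : (k:ℝ) ≠ 0 := by exact_mod_cast h
    rw [intervalIntegral.integral_comp_mul_left (fun x => Real.cos x) hk, integral_cos]
    simp [Real.sin_int_mul_pi]

theorem PJ_cos2 (k : ℤ) : ∫ θ in (0:ℝ)..Real.pi, Real.cos ((k:ℝ) * θ) * (1 - Real.cos θ) =
    (if k = 0 then Real.pi else 0) - ((if k + 1 = 0 then Real.pi else 0) + (if k - 1 = 0 then Real.pi else 0)) / 2 := by
  have e : ∀ θ : ℝ, Real.cos ((k:ℝ) * θ) * (1 - Real.cos θ) = Real.cos ((k:ℝ) * θ) - (Real.cos (((k + 1 : ℤ):ℝ) * θ) + Real.cos (((k - 1 : ℤ):ℝ) * θ)) / 2 := by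
    intro θ
    push_cast
    rw [add_mul, sub_mul, one_mul, Real.cos_add, Real.cos_sub]
    ring
  simp_rw [e]
  have ii : ∀ k : ℤ, IntervalIntegrable (fun θ => Real.cos ((k:ℝ) * θ)) MeasureTheory.volume 0 Real.pi := fun k =>
    Continuous.intervalIntegrable (by fun_prop) _ _
  rw [intervalIntegral.integral_sub (ii _) (((ii _).add (ii _)).div_const 2), intervalIntegral.integral_div,
    intervalIntegral.integral_add (ii _) (ii _), PJ_cos, PJ_cos, PJ_cos]

theorem PJ_main (t : ℝ) (ht : 0 < t) (n : ℕ) (hn : 1 ≤ n) (hI : 0 ≤ ∫ θ in (0:ℝ)..Real.pi, Pf t n θ) :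
    p (n - 1) * p (n + 1) ≤ p n ^ 2 := by
  have hD := intervalIntegral.hasSum_integral_of_dominated_convergence (μ := MeasureTheory.volume) (a := 0) (b := Real.pi)
    (F := fun (m : ℕ) θ => (p m : ℝ) * Real.exp (-t) ^ m * (Real.cos (((m:ℝ) - n) * θ) * (1 - Real.cos θ)))
    (f := fun θ => Real.exp (∑' x, Pa t x) * Pf t n θ) (fun m _ => (p m : ℝ) * Real.exp (-t) ^ m * 2)
    (fun m => Continuous.aestronglyMeasurable (by fun_prop))
    (fun m => Filter.Eventually.of_forall fun θ _ => PJ_bd t θ n m)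
    (Filter.Eventually.of_forall fun θ _ => (PJ_w t ht).mul_right 2)
    (by simp)
    (Filter.Eventually.of_forall fun θ _ => PJ_hasSum t θ ht n)
  rw [intervalIntegral.integral_const_mul] at hD
  set w : ℕ → ℝ := fun m => (p m : ℝ) * Real.exp (-t) ^ m with hw
  have hF : (fun m : ℕ => ∫ θ in (0:ℝ)..Real.pi, (p m : ℝ) * Real.exp (-t) ^ m * (Real.cos (((m:ℝ) - n) * θ) * (1 - Real.cos θ))) =
      fun m : ℕ => (if m = n then w n * Real.pi else 0) - ((if m = n - 1 then w (n - 1) * Real.pi else 0) + (if m = n + 1 then w (n + 1) * Real.pi else 0)) / 2 := by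
    ext m
    rw [intervalIntegral.integral_const_mul]
    have := PJ_cos2 ((m:ℤ) - n)
    push_cast at this
    rw [this]
    have a1 : ((m:ℤ) - n = 0) ↔ m = n := by omega
    have a2 : ((m:ℤ) - n + 1 = 0) ↔ m = n - 1 := by omega
    have a3 : ((m:ℤ) - n - 1 = 0) ↔ m = n + 1 := by omega
    simp only [a1, a2, a3]
    have b : ∀ k, (if m = k then w k * Real.pi else 0) = w m * (if m = k then Real.pi else 0) := by
      intro k; split_ifs with h
      · rw [h]
      · ring
    rw [b, b, b]; ring
  rw [hF] at hD
  have hE := (hasSum_ite_eq n (w n * Real.pi)).sub (((hasSum_ite_eq (n - 1) (w (n - 1) * Real.pi)).add (hasSum_ite_eq (n + 1) (w (n + 1) * Real.pi))).div_const 2)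
  have key := hD.unique hE
  have hpos : 0 ≤ Real.exp (∑' x, Pa t x) * ∫ θ in (0:ℝ)..Real.pi, Pf t n θ := mul_nonneg (Real.exp_pos _).le hI
  rw [key] at hpos
  have h1 : (w (n - 1) + w (n + 1)) / 2 ≤ w n := by
    have : 0 ≤ Real.pi * (w n - (w (n - 1) + w (n + 1)) / 2) := by linarith
    have := nonneg_of_mul_nonneg_right this Real.pi_pos
    linarith
  have hw0 : ∀ m, 0 ≤ w m := fun m => by rw [hw]; positivity
  have h2 : w (n - 1) * w (n + 1) ≤ w n ^ 2 := by
    have : ((w (n - 1) + w (n + 1)) / 2) ^ 2 ≤ w n ^ 2 := by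
      have := hw0 (n - 1); have := hw0 (n + 1)
      gcongr
    nlinarith [sq_nonneg (w (n - 1) - w (n + 1))]
  have e1 : w (n - 1) * w (n + 1) = ((p (n - 1) : ℝ) * p (n + 1)) * Real.exp (-t) ^ (2 * n) := by
    simp only [hw]
    rw [show 2 * n = (n - 1) + (n + 1) by omega, pow_add]; ring
  have e2 : w n ^ 2 = ((p n : ℝ) ^ 2) * Real.exp (-t) ^ (2 * n) := by
    simp only [hw]
    rw [mul_pow, ← pow_mul, mul_comm n 2]
  rw [e1, e2] at h2
  have := le_of_mul_le_mul_right h2 (by positivity)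
  exact_mod_cast this

theorem PK_V1 (t θ : ℝ) (ht : 0 < t) : PV t θ ≤ (θ ^ 2 / 2) * ((2 / t ^ 3) * (Real.pi ^ 2 / 6)) := by
  obtain ⟨h1, h2⟩ := PE_K2 t ht
  have hs : Summable fun x => Pa t x * (1 - Real.cos (Pm x * θ)) :=
    Pa_summable_mul t ht _ 2 fun x => by
      rw [abs_le]; constructor <;> linarith [Real.cos_le_one (Pm x * θ), Real.neg_one_le_cos (Pm x * θ)]
  refine le_trans ?_ (mul_le_mul_of_nonneg_left h2 (by positivity))
  rw [← h1.tsum_mul_left]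
  unfold PV
  refine hs.tsum_le_tsum (fun x => ?_) (h1.mul_left _)
  have hc := Real.one_sub_sq_div_two_le_cos (x := Pm x * θ)
  calc Pa t x * (1 - Real.cos (Pm x * θ)) ≤ Pa t x * ((Pm x * θ) ^ 2 / 2) :=
        mul_le_mul_of_nonneg_left (by linarith) (Pa_pos t x).le
    _ = _ := by unfold Pa Pm; field_simp

theorem PK_ph (t θ n : ℝ) (ht : 0 < t) (hθ : 0 ≤ θ)
    (hn : ∑' x : ℕ × ℕ, ((x.2:ℝ) + 1) * Real.exp (-t) ^ ((x.1 + 1) * (x.2 + 1)) = n) :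
    |PPh t θ - n * θ| ≤ (θ ^ 3 / 6) * ((20 / 3 / t ^ 4) * (Real.pi ^ 2 / 6)) := by
  obtain ⟨h1, h2⟩ := PE_K3 t ht
  obtain ⟨k1, -⟩ := PE_K1 t ht
  have hs := Pa_summable_mul t ht (fun x => Real.sin (Pm x * θ)) 1 fun x => Real.abs_sin_le_one _
  refine le_trans ?_ (mul_le_mul_of_nonneg_left h2 (by positivity))
  have hh := (hs.hasSum.sub ((hn ▸ k1.hasSum).mul_right θ))
  rw [← h1.tsum_mul_left]
  have hb : ∀ x, ‖Pa t x * Real.sin (Pm x * θ) - ((x.2:ℝ) + 1) * Real.exp (-t) ^ ((x.1 + 1) * (x.2 + 1)) * θ‖ ≤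
      θ ^ 3 / 6 * (((x.1:ℝ) + 1) ^ 2 * (((x.2:ℝ) + 1) ^ 3 * Real.exp (-t) ^ ((x.1 + 1) * (x.2 + 1)))) := by
    intro x
    have hm : 0 ≤ Pm x * θ := mul_nonneg (Pm_pos x).le hθ
    have e : ((x.2:ℝ) + 1) * Real.exp (-t) ^ ((x.1 + 1) * (x.2 + 1)) * θ = Pa t x * (Pm x * θ) := by
      unfold Pa Pm; field_simp
    rw [e, ← mul_sub, Real.norm_eq_abs, abs_mul, abs_of_pos (Pa_pos t x)]
    have hsn : |Real.sin (Pm x * θ) - Pm x * θ| ≤ (Pm x * θ) ^ 3 / 6 := by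
      have a := Real.sin_ge_sub_cube hm
      have b := Real.sin_le hm
      rw [abs_le]; constructor <;> [linarith; nlinarith [pow_nonneg hm 3]]
    calc _ ≤ Pa t x * ((Pm x * θ) ^ 3 / 6) := mul_le_mul_of_nonneg_left hsn (Pa_pos t x).le
      _ = _ := by unfold Pa Pm; field_simp
  have := tsum_of_norm_bounded (h1.mul_left (θ ^ 3 / 6)).hasSum hb
  rw [hh.tsum_eq] at this
  exact this

theorem PK_row (t θ : ℝ) (ht : 0 < t) :
    HasSum (fun d : ℕ => Real.exp (-t) ^ (d + 1) * (1 - Real.cos (((d:ℝ) + 1) * θ)))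
      (Real.exp (-t) * (1 + Real.exp (-t)) * (1 - Real.cos θ) /
        ((1 - Real.exp (-t)) * ((1 - Real.exp (-t)) ^ 2 + 2 * Real.exp (-t) * (1 - Real.cos θ)))) := by
  have hr1 : Real.exp (-t) < 1 := by rw [Real.exp_lt_one_iff]; linarith
  have hr0 := Real.exp_pos (-t)
  have hn := PI_norm t θ ht
  have g := (hasSum_geometric_of_norm_lt_one hn).mul_left ((Real.exp (-t) : ℂ) * Complex.exp (θ * Complex.I))
  have h2 := Complex.hasSum_re g
  have h1 := PE_g0 _ hr0 hr1
  have hh := h1.sub h2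
  set r := Real.exp (-t)
  have ef : (fun d : ℕ => r ^ (d + 1) * (1 - Real.cos (((d:ℝ) + 1) * θ))) =
      fun d : ℕ => r ^ (d + 1) - ((r : ℂ) * Complex.exp (θ * Complex.I) * ((r : ℂ) * Complex.exp (θ * Complex.I)) ^ d).re := by
    ext d
    rw [← pow_succ', mul_pow, ← Complex.exp_nat_mul]
    have e : ((d + 1 : ℕ) : ℂ) * (θ * Complex.I) = ((((d:ℝ) + 1) * θ : ℝ) : ℂ) * Complex.I := by push_cast; ring
    rw [e, ← Complex.ofReal_pow, Complex.re_ofReal_mul, Complex.exp_ofReal_mul_I_re]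
    ring
  have hD : 0 < (1 - r) ^ 2 + 2 * r * (1 - Real.cos θ) := by
    have : 0 < 1 - r := by linarith
    have := Real.cos_le_one θ
    have : 0 ≤ 2 * r * (1 - Real.cos θ) := by apply mul_nonneg <;> linarith
    positivity
  have ev : ((r : ℂ) * Complex.exp (θ * Complex.I) * (1 - (r : ℂ) * Complex.exp (θ * Complex.I))⁻¹).re =
      (r * (1 - r) - r * (1 - Real.cos θ)) / ((1 - r) ^ 2 + 2 * r * (1 - Real.cos θ)) := by
    have sc := Real.sin_sq_add_cos_sq θ
    have ns : Complex.normSq (1 - (r : ℂ) * Complex.exp (θ * Complex.I)) = (1 - r) ^ 2 + 2 * r * (1 - Real.cos θ) := by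
      rw [Complex.normSq_apply]
      simp only [Complex.sub_re, Complex.sub_im, Complex.one_re, Complex.one_im, Complex.re_ofReal_mul, Complex.im_ofReal_mul, Complex.exp_ofReal_mul_I_re, Complex.exp_ofReal_mul_I_im]
      linear_combination r ^ 2 * sc
    rw [Complex.mul_re, Complex.inv_re, Complex.inv_im, ns]
    simp only [Complex.sub_re, Complex.sub_im, Complex.one_re, Complex.one_im, Complex.re_ofReal_mul, Complex.im_ofReal_mul, Complex.exp_ofReal_mul_I_re, Complex.exp_ofReal_mul_I_im]
    generalize (1 - r) ^ 2 + 2 * r * (1 - Real.cos θ) = Dn at hD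
    field_simp
    linear_combination (-r) * sc
  rw [ev] at hh
  have e3 : r * (1 + r) * (1 - Real.cos θ) / ((1 - r) * ((1 - r) ^ 2 + 2 * r * (1 - Real.cos θ))) =
      r / (1 - r) - (r * (1 - r) - r * (1 - Real.cos θ)) / ((1 - r) ^ 2 + 2 * r * (1 - Real.cos θ)) := by
    have : 1 - r ≠ 0 := by linarith
    rw [div_sub_div _ _ this hD.ne']
    congr 1; ring
  rw [ef, e3]
  exact hh

theorem PK_V2 (t θ : ℝ) (ht : 0 < t) (ht1 : t ≤ 0.1) :
    (1 / t) * ((1 - Real.cos θ) / (Real.cosh t - 1 + (1 - Real.cos θ))) ≤ PV t θ := by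
  have hs : Summable fun x => Pa t x * (1 - Real.cos (Pm x * θ)) :=
    Pa_summable_mul t ht _ 2 fun x => by
      rw [abs_le]; constructor <;> linarith [Real.cos_le_one (Pm x * θ), Real.neg_one_le_cos (Pm x * θ)]
  have hnn : ∀ x, 0 ≤ Pa t x * (1 - Real.cos (Pm x * θ)) := fun x =>
    mul_nonneg (Pa_pos t x).le (by linarith [Real.cos_le_one (Pm x * θ)])
  have hrow := PK_row t θ ht
  have h1 : ∑' d : ℕ, Pa t (0, d) * (1 - Real.cos (Pm (0, d) * θ)) ≤ PV t θ := by
    unfold PV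
    exact tsum_comp_le_tsum_of_inj hs hnn (i := fun d : ℕ => ((0, d) : ℕ × ℕ)) (fun a b h => by simpa using h)
  have e0 : (fun d : ℕ => Pa t (0, d) * (1 - Real.cos (Pm (0, d) * θ))) = fun d : ℕ => Real.exp (-t) ^ (d + 1) * (1 - Real.cos (((d:ℝ) + 1) * θ)) := by
    ext d; simp [Pa, Pm]
  rw [e0, hrow.tsum_eq] at h1
  refine le_trans ?_ h1
  have hr1 : Real.exp (-t) < 1 := by rw [Real.exp_lt_one_iff]; linarith
  have hr0 := Real.exp_pos (-t)
  have hch : Real.cosh t - 1 = (1 - Real.exp (-t)) ^ 2 / (2 * Real.exp (-t)) := by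
    rw [Real.cosh_eq]
    have : Real.exp t * Real.exp (-t) = 1 := by rw [← Real.exp_add]; simp
    field_simp
    linear_combination this
  have hr : 2 * (1 - Real.exp (-t)) ≤ t * (1 + Real.exp (-t)) := by
    have hb := Real.exp_bound (x := -t) (by rw [abs_neg, abs_of_pos ht]; norm_num at *; linarith) (n := 4) (by norm_num)
    rw [abs_le] at hb
    have := hb.1
    simp only [Finset.sum_range_succ, Finset.sum_range_zero, abs_neg, abs_of_pos ht] at this
    norm_num [Nat.factorial] at this
    have h3 : 0 < t ^ 3 := by positivity
    have h4 : t ^ 4 ≤ 0.1 * t ^ 3 := by rw [show t ^ 4 = t * t ^ 3 by ring]; gcongr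
    have h5 : (2 + t) * (1 - t + t ^ 2 / 2 - t ^ 3 / 6 - t ^ 4 * (5 / 96)) ≤ (2 + t) * Real.exp (-t) := by
      gcongr; linarith
    have h6 : (2 + t) * (1 - t + t ^ 2 / 2 - t ^ 3 / 6 - t ^ 4 * (5 / 96)) = 2 - t + t ^ 3 / 6 - t ^ 4 / 6 - t ^ 4 * (5 / 48) - t * (t ^ 4 * (5 / 96)) := by ring
    have h7 : t * (t ^ 4 * (5 / 96)) ≤ 0.1 * (t ^ 4 * (5 / 96)) := by gcongr
    norm_num at *
    nlinarith
  set r := Real.exp (-t)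
  rw [hch]
  have hc : 0 ≤ 1 - Real.cos θ := by linarith [Real.cos_le_one θ]
  set c := 1 - Real.cos θ
  have h1r : 0 < 1 - r := by linarith
  have e : r * (1 + r) * c / ((1 - r) * ((1 - r) ^ 2 + 2 * r * c)) = ((1 + r) / (2 * (1 - r))) * (c / ((1 - r) ^ 2 / (2 * r) + c)) := by
    field_simp
  rw [e]
  gcongr ?_ * _
  rw [div_le_div_iff₀ ht (by positivity)]
  linarith

theorem PK_ivt (n : ℕ) (hn : 1 ≤ n) : ∃ t : ℝ, 0 < t ∧ t ^ 2 * n ≤ Real.pi ^ 2 / 6 ∧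
    ∑' x : ℕ × ℕ, ((x.2:ℝ) + 1) * Real.exp (-t) ^ ((x.1 + 1) * (x.2 + 1)) = n := by
  have hn0 : (1:ℝ) ≤ n := by exact_mod_cast hn
  have hn1 : (0:ℝ) < n := by linarith
  set κ : ℝ → ℝ := fun t => ∑' x : ℕ × ℕ, ((x.2:ℝ) + 1) * Real.exp (-t) ^ ((x.1 + 1) * (x.2 + 1)) with hκ
  set t1 := √(1 / (2 * n)) with ht1
  set t2 := √((Real.pi ^ 2 / 6) / n) with ht2
  have hpi := Real.pi_gt_three
  have p1 : 0 < t1 := Real.sqrt_pos.2 (by positivity)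
  have p2 : 0 < t2 := Real.sqrt_pos.2 (by positivity)
  have s1 : t1 ^ 2 = 1 / (2 * n) := Real.sq_sqrt (by positivity)
  have s2 : t2 ^ 2 = (Real.pi ^ 2 / 6) / n := Real.sq_sqrt (by positivity)
  have h12 : t1 ≤ t2 := by
    apply Real.sqrt_le_sqrt
    rw [← div_div]
    exact div_le_div_of_nonneg_right (by nlinarith) hn1.le
  have hcont : ContinuousOn κ (Set.Icc t1 t2) := by
    refine continuousOn_tsum (fun x => by fun_prop) (PE_K1 t1 p1).1 fun x t ht => ?_
    rw [Real.norm_of_nonneg (by positivity)]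
    gcongr
    exact ht.1
  have v2 : κ t2 ≤ n := by
    refine (PE_K1 t2 p2).2.trans (le_of_eq ?_)
    rw [s2]; field_simp
  have v1 : (n:ℝ) ≤ κ t1 := by
    have hr1 : Real.exp (-t1) < 1 := by rw [Real.exp_lt_one_iff]; linarith
    have hr0 := Real.exp_pos (-t1)
    have hrow := PE_g1 _ hr0 hr1
    have h1 : ∑' d : ℕ, ((d:ℝ) + 1) * Real.exp (-t1) ^ ((0 + 1) * (d + 1)) ≤ κ t1 :=
      tsum_comp_le_tsum_of_inj (PE_K1 t1 p1).1 (fun x => by positivity) (i := fun d : ℕ => ((0, d) : ℕ × ℕ)) (fun a b h => by simpa using h)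
    simp only [zero_add, one_mul] at h1
    rw [hrow.tsum_eq] at h1
    refine le_trans ?_ h1
    have hE := Real.cosh_le_exp_half_sq t1
    have hy0 : t1 ^ 2 / 2 ≤ 1 / 4 := by
      rw [s1, ← one_div_mul_one_div]
      have : 1 / (n:ℝ) ≤ 1 := by rw [div_le_one hn1]; exact hn0
      linarith
    have hy := Real.abs_exp_sub_one_sub_id_le (x := t1 ^ 2 / 2) (by rw [abs_of_nonneg (by positivity)]; linarith)
    rw [abs_le] at hy
    have hy2 := hy.2
    have hq : (t1 ^ 2 / 2) ^ 2 ≤ 1 / 4 * (t1 ^ 2 / 2) := by rw [sq]; gcongr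
    have hch : Real.cosh t1 = 1 + (1 - Real.exp (-t1)) ^ 2 / (2 * Real.exp (-t1)) := by
      rw [Real.cosh_eq]
      have : Real.exp t1 * Real.exp (-t1) = 1 := by rw [← Real.exp_add]; simp
      field_simp
      linear_combination this
    rw [hch] at hE
    have hfin : (1 - Real.exp (-t1)) ^ 2 / (2 * Real.exp (-t1)) ≤ t1 ^ 2 := by linarith [sq_nonneg t1]
    rw [s1, div_le_div_iff₀ (by positivity) (by positivity)] at hfin
    rw [le_div_iff₀ (by apply pow_pos; linarith)]
    linarith
  obtain ⟨t, ht, hκt⟩ := intermediate_value_Icc' h12 hcont ⟨v2, v1⟩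
  refine ⟨t, lt_of_lt_of_le p1 ht.1, ?_, hκt⟩
  have : t ^ 2 ≤ t2 ^ 2 := by
    have := lt_of_lt_of_le p1 ht.1
    gcongr; exact ht.2
  rw [s2, le_div_iff₀ hn1] at this
  exact this

theorem PK_large (n : ℕ) (hn : 16383 ≤ n) : p (n - 1) * p (n + 1) ≤ p n ^ 2 := by
  obtain ⟨t, ht, htn, hκ⟩ := PK_ivt n (by omega)
  refine PJ_main t ht n (by omega) ?_
  have hA : Real.pi ^ 2 / 6 ≤ 1.645 := by nlinarith [Real.pi_lt_d6, Real.pi_pos]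
  have hn' : (16383:ℝ) ≤ n := by exact_mod_cast hn
  have ht2 : t ^ 2 * 16383 ≤ 1.645 := by nlinarith [sq_nonneg t]
  have htu : t ≤ 0.01003 := by
    by_contra hc
    push Not at hc
    norm_num at *
    nlinarith
  set x := √(1 / t) with hx
  have hx2 : x ^ 2 = 1 / t := Real.sq_sqrt (by positivity)
  have hx0 : 0 < x := Real.sqrt_pos.2 (by positivity)
  have hxt : t = 1 / x ^ 2 := by rw [hx2]; simp
  have hx9 : 9.98 ≤ x := by
    apply Real.le_sqrt_of_sq_le
    rw [le_div_iff₀ ht]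
    norm_num at *; linarith
  refine PH_int x (PV t) (fun θ => PPh t θ - n * θ) (Pf t n) hx9 (PJ_cont t ht n) (fun θ => rfl) (fun θ h0 => ?_) (fun θ h0 => ?_) (fun θ h0 => ?_)
  · refine (PK_V1 t θ ht).trans ?_
    have e : θ ^ 2 / 2 * (2 / t ^ 3 * (Real.pi ^ 2 / 6)) = (Real.pi ^ 2 / 6) * (θ * x ^ 3) ^ 2 := by
      rw [hxt]; field_simp
    rw [e]; gcongr
  · refine (PK_ph t θ n ht h0 hκ).trans ?_
    have e : θ ^ 3 / 6 * (20 / 3 / t ^ 4 * (Real.pi ^ 2 / 6)) = (10 / 9 * (Real.pi ^ 2 / 6)) * (θ * x ^ 3) ^ 3 / x := by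
      rw [hxt]; field_simp; ring
    rw [e]; gcongr
    norm_num at *; linarith
  · have := PK_V2 t θ ht (by norm_num at *; linarith)
    rw [← hx2] at this
    rw [← hxt]; exact this

theorem PK_lc (n : ℕ) (hn : 26 ≤ n) : p (n - 1) * p (n + 1) ≤ p n ^ 2 := by
  by_cases h : n + 1 < 2 ^ 14
  · exact (kcheck_sound 105 14 (by norm_num) (by norm_num) PI_512 kcheck_true).1 n hn h
  · exact PK_large n (by norm_num at h; omega)

theorem PK_pos (n : ℕ) : 0 < p n := by
  unfold p; exact Fintype.card_pos

theorem PK_chain (b : ℕ) (hb : 25 ≤ b) (k : ℕ) : p (b + k + 1) * p b ≤ p (b + k) * p (b + 1) := by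
  induction k with
  | zero => simp [mul_comm]
  | succ k ih =>
    have h := PK_lc (b + k + 1) (by omega)
    have e : b + k + 1 - 1 = b + k := by omega
    rw [e] at h
    have h0 := PK_pos (b + k)
    have hc : p (b + k) * (p (b + k + 1 + 1) * p b) ≤ p (b + k) * (p (b + k + 1) * p (b + 1)) := by
      calc p (b + k) * (p (b + k + 1 + 1) * p b) = (p (b + k) * p (b + k + 1 + 1)) * p b := by ring
        _ ≤ p (b + k + 1) ^ 2 * p b := Nat.mul_le_mul_right _ h
        _ = p (b + k + 1) * (p (b + k + 1) * p b) := by ring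
        _ ≤ p (b + k + 1) * (p (b + k) * p (b + 1)) := Nat.mul_le_mul_left _ ih
        _ = _ := by ring
    exact Nat.le_of_mul_le_mul_left hc h0

theorem PK_comb (A A1 B B1 C C1 : ℕ) (hC : 0 < C) (hC1 : 0 < C1) (h1 : A * C ≤ A1 * C1) (h2 : C1 * B ≤ C * B1) :
    A * B ≤ A1 * B1 := by
  have h3 : C * C1 * (A * B) ≤ C * C1 * (A1 * B1) := by
    calc C * C1 * (A * B) = (A * C) * (C1 * B) := by ring
      _ ≤ (A1 * C1) * (C * B1) := Nat.mul_le_mul h1 h2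
      _ = _ := by ring
  exact Nat.le_of_mul_le_mul_left h3 (Nat.mul_pos hC hC1)

theorem PK_odd (b a c : ℕ) (hc : c = 26) (hab : c < a)
    (h2 : p (c + 1) * p b ≤ p (c + 1 - 1) * p (b + 1)) : p a * p b ≤ p (a - 1) * p (b + 1) := by
  have h1 := PK_chain c (by omega) (a - 1 - c)
  rw [show c + (a - 1 - c) + 1 = a by omega, show c + (a - 1 - c) = a - 1 by omega] at h1
  rw [Nat.add_sub_cancel] at h2
  exact PK_comb _ _ _ _ _ _ (PK_pos _) (PK_pos _) h1 h2

theorem PK_ksmall (b : ℕ) (hb : b < 26) (ho : Odd b) (a : ℕ) (ha : a < 28) (hab : b + 1 < a) :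
    p a * p b ≤ p (a - 1) * p (b + 1) :=
  (kcheck_sound 105 14 (by norm_num) (by norm_num) PI_512 kcheck_true).2 b hb ho a ha hab

theorem stmt9 (a b : ℕ) (ha : 0 < a) (hb : 0 < b) (hab : b + 1 < a) (h : Odd b ∨ 26 ≤ b) :
    p a * p b ≤ p (a - 1) * p (b + 1) := by
  by_cases h26 : 26 ≤ b
  · have := PK_chain b (by omega) (a - 1 - b)
    rwa [show b + (a - 1 - b) + 1 = a by omega, show b + (a - 1 - b) = a - 1 by omega] at this
  · have ho : Odd b := by tauto
    by_cases ha28 : a < 28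
    · exact PK_ksmall b (by omega) ho a ha28 hab
    · obtain ⟨c, hc⟩ : ∃ c : ℕ, c = 26 := ⟨26, rfl⟩
      exact PK_odd b a c hc (by omega) (PK_ksmall b (by omega) ho (c + 1) (by omega) (by omega))
end
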